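/- arXiv:0801.0173 — 5 statements merged into one kernel-verified Lean document; each statement's English description precedes it below -/
import Mathlib

section
/- Let K be a field and T a K-linear triangulated category such that for all objects A, B of T the K-vector space ⊕_{k∈ℤ} Hom_T(A, B[k]) is finite-dimensional. Suppose given two distinguished triangles A --f--> B --g--> C --h--> A[1] and A --f'--> B' --g'--> C' --h'--> A[1] with the same first object A, and morphisms b : B → B' and c : C → C' such that b ∘ f = f', c ∘ g = g' ∘ b, and h' ∘ c = h (i.e. (id_A, b, c) is a morphism of triangles). Then any cone of c is isomorphic to any cone of b; that is, if B' --u--> D --v--> B[1] completes b to a distinguished triangle B --b--> B' --u--> D --v--> B[1] and C' --u'--> D' --v'--> C[1] completes c to a distinguished triangle C --c--> C' --u'--> D' --v'--> C[1], then D ≅ D'. -/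
open CategoryTheory CategoryTheory.Limits CategoryTheory.Pretriangulated

section LinAlg
open Module

theorem aux_map_inf {K V W : Type*} [Field K] [AddCommGroup V] [Module K V] [AddCommGroup W]
    [Module K W] [FiniteDimensional K V] (U : Submodule K V) (L : V →ₗ[K] W) :
    finrank K (U.map L) + finrank K (U ⊓ LinearMap.ker L : Submodule K V) = finrank K U := by
  have h := LinearMap.finrank_range_add_finrank_ker (L.domRestrict U)
  rw [LinearMap.range_domRestrict] at h
  rw [← h]
  congr 1
  rw [LinearMap.ker_domRestrict, ← Submodule.map_comap_subtype]
  exact (Submodule.equivMapOfInjective U.subtype U.injective_subtype _).symm.finrank_eq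

/-- The rank of `c` in a ladder of exact sequences. -/
theorem aux_ladder {K A B C B' C' A' : Type*} [Field K]
    [AddCommGroup A] [Module K A] [AddCommGroup B] [Module K B] [AddCommGroup C] [Module K C]
    [AddCommGroup B'] [Module K B'] [AddCommGroup C'] [Module K C']
    [AddCommGroup A'] [Module K A']
    [FiniteDimensional K B'] [FiniteDimensional K C']
    (f : A →ₗ[K] B) (g : B →ₗ[K] C) (h : C →ₗ[K] A')
    (f' : A →ₗ[K] B') (g' : B' →ₗ[K] C') (h' : C' →ₗ[K] A')
    (b : B →ₗ[K] B') (c : C →ₗ[K] C')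
    (e2 : LinearMap.range g = LinearMap.ker h)
    (e3 : LinearMap.range f' = LinearMap.ker g')
    (hb : b ∘ₗ f = f') (hbc : c ∘ₗ g = g' ∘ₗ b) (hc : h' ∘ₗ c = h) :
    finrank K (LinearMap.range c) + finrank K (LinearMap.range f') =
      finrank K (LinearMap.range h) + finrank K (LinearMap.range b) := by
  have h1 := aux_map_inf (LinearMap.range c) h'
  have h2 := aux_map_inf (LinearMap.range b) g'
  rw [← LinearMap.range_comp, hc] at h1
  rw [← LinearMap.range_comp, ← e3, inf_eq_right.2 (by rw [← hb]; exact LinearMap.range_comp_le_range _ _)] at h2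
  have : LinearMap.range c ⊓ LinearMap.ker h' = LinearMap.range (g' ∘ₗ b) := by
    rw [← hbc]
    ext x
    constructor
    · rintro ⟨⟨z, rfl⟩, hz⟩
      have : z ∈ LinearMap.ker h := by rw [← hc]; exact hz
      rw [← e2] at this
      obtain ⟨y, rfl⟩ := this
      exact ⟨y, rfl⟩
    · rintro ⟨y, rfl⟩
      refine ⟨⟨g y, rfl⟩, ?_⟩
      have : g y ∈ LinearMap.ker h := by rw [← e2]; exact ⟨y, rfl⟩
      rw [← hc] at this
      exact this
  rw [this] at h1
  omega

theorem aux_idem {K R : Type*} [Field K] [Ring R] [Algebra K R] [FiniteDimensional K R]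
    (z : R) (hz : ¬ IsNilpotent z) :
    ∃ w : R, z * w = w * z ∧ (z * w) * (z * w) = z * w ∧ z * w ≠ 0 := by
  let _ : CommRing (Algebra.adjoin K {z}) := Algebra.adjoinCommRingOfComm K (by
    rintro a rfl b rfl; rfl)
  let ζ : Algebra.adjoin K {z} := ⟨z, Algebra.subset_adjoin rfl⟩
  have : IsArtinianRing (Algebra.adjoin K {z}) := IsArtinianRing.of_finite K _
  obtain ⟨n, y, hy⟩ := IsArtinian.exists_pow_succ_smul_dvd ζ (1 : Algebra.adjoin K {z})
  simp only [smul_eq_mul, mul_one] at hy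
  have key : ∀ m, ζ ^ n * (ζ ^ m * y ^ m) = ζ ^ n := by
    intro m
    induction m with
    | zero => simp
    | succ m ih =>
      calc ζ ^ n * (ζ ^ (m+1) * y ^ (m+1)) = (ζ ^ n.succ * y) * (ζ ^ m * y ^ m) := by
            rw [Nat.succ_eq_add_one]; ring
        _ = _ := by rw [hy, ih]
  have k1 := key (n+1)
  have e : (ζ * (ζ ^ n * y ^ (n+1))) * (ζ * (ζ ^ n * y ^ (n+1))) = ζ * (ζ ^ n * y ^ (n+1)) := by
    calc _ = (ζ ^ n * (ζ ^ (n+1) * y ^ (n+1))) * (ζ * y ^ (n+1)) := by ring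
      _ = _ := by rw [k1]; ring
  refine ⟨(ζ ^ n * y ^ (n+1) : Algebra.adjoin K {z}), ?_, ?_, ?_⟩
  · exact congrArg Subtype.val (mul_comm ζ (ζ ^ n * y ^ (n+1)))
  · exact congrArg Subtype.val e
  · intro h0
    have h0' : ζ * (ζ ^ n * y ^ (n+1)) = 0 := Subtype.ext h0
    apply hz
    refine ⟨n, ?_⟩
    have : ζ ^ n = 0 := by
      rw [← k1, pow_succ' ζ n, mul_assoc, h0', mul_zero]
    exact congrArg Subtype.val this

theorem aux_jac {R : Type*} [Ring R] {ι : Type*} (s : Finset ι) (z : ι → R)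
    (hz : ∀ i, ∀ y, IsNilpotent (y * z i)) : ∃ w, w * (1 - ∑ i ∈ s, z i) = 1 := by
  have h : ∀ i, z i ∈ Ideal.jacobson (⊥ : Ideal R) := by
    intro i
    rw [Ideal.mem_jacobson_iff]
    intro y
    obtain ⟨u, hu⟩ := (hz i y).isUnit_add_one
    refine ⟨(u⁻¹ : Rˣ), ?_⟩
    have : ((u⁻¹ : Rˣ) : R) * (y * z i + 1) = 1 := by rw [← hu]; simp
    rw [Ideal.mem_bot, ← this]
    noncomm_ring
  have h2 := Ideal.sum_mem _ (fun i (_ : i ∈ s) => h i)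
  obtain ⟨w, hw⟩ := Ideal.mem_jacobson_iff.1 h2 (-1)
  refine ⟨w, ?_⟩
  rw [Ideal.mem_bot, sub_eq_zero] at hw
  refine Eq.trans ?_ hw
  noncomm_ring

end LinAlg

section Cat
open Module
universe v u w
variable {K : Type w} [Field K] {C : Type u} [Category.{v} C] [Preadditive C] [Linear K C]

theorem aux_split (hf : ∀ X Y : C, FiniteDimensional K (X ⟶ Y)) {X Y Z : C} (φ : X ⟶ Y)
    (a : Z ⟶ Z) (ha : a ≫ a = a) :
    finrank K (LinearMap.range (Linear.rightComp K X a ∘ₗ Linear.leftComp K Z φ)) +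
    finrank K (LinearMap.range (Linear.rightComp K X (𝟙 Z - a) ∘ₗ Linear.leftComp K Z φ)) =
    finrank K (LinearMap.range (Linear.leftComp K Z φ)) := by
  rw [← aux_map_inf (LinearMap.range (Linear.leftComp K Z φ)) (Linear.rightComp K X a),
    ← LinearMap.range_comp]
  have : LinearMap.range (Linear.rightComp K X (𝟙 Z - a) ∘ₗ Linear.leftComp K Z φ) =
    LinearMap.range (Linear.leftComp K Z φ) ⊓ LinearMap.ker (Linear.rightComp K X a) := by
    ext x
    constructor
    · rintro ⟨y, rfl⟩
      refine ⟨⟨y ≫ (𝟙 Z - a), by simp⟩, ?_⟩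
      simp [ha]
    · rintro ⟨⟨y, rfl⟩, hy⟩
      refine ⟨y, ?_⟩
      have hy : (φ ≫ y) ≫ a = 0 := hy
      simp at hy
      simp [hy]
  rw [this]

theorem aux_le (hf : ∀ X Y : C, FiniteDimensional K (X ⟶ Y)) {X Y M N : C} (φ : X ⟶ Y)
    (f : M ⟶ N) (p : N ⟶ M) (hp : p ≫ f ≫ p = p) :
    finrank K (LinearMap.range (Linear.rightComp K X (f ≫ p) ∘ₗ Linear.leftComp K M φ)) ≤
    finrank K (LinearMap.range (Linear.rightComp K X (p ≫ f) ∘ₗ Linear.leftComp K N φ)) := by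
  refine le_trans (Submodule.finrank_mono ?_) (Submodule.finrank_map_le (Linear.rightComp K X p) _)
  rintro _ ⟨y, rfl⟩
  refine ⟨_, ⟨y ≫ f, rfl⟩, ?_⟩
  simp [hp]

theorem aux_compl (hf : ∀ X Y : C, FiniteDimensional K (X ⟶ Y)) {M N : C}
    (hR : ∀ {X Y : C} (φ : X ⟶ Y), finrank K (LinearMap.range (Linear.leftComp K M φ)) =
      finrank K (LinearMap.range (Linear.leftComp K N φ)))
    (f : M ⟶ N) (p : N ⟶ M) (hf' : f ≫ p ≫ f = f) (hp : p ≫ f ≫ p = p) {X Y : C} (φ : X ⟶ Y) :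
    finrank K (LinearMap.range (Linear.rightComp K X (𝟙 M - f ≫ p) ∘ₗ Linear.leftComp K M φ)) =
    finrank K (LinearMap.range (Linear.rightComp K X (𝟙 N - p ≫ f) ∘ₗ Linear.leftComp K N φ)) := by
  have h1 := aux_split (K := K) hf φ (f ≫ p) (by simp [hp])
  have h2 := aux_split (K := K) hf φ (p ≫ f) (by simp [hf'])
  have h3 := aux_le (K := K) hf φ f p hp
  have h4 := aux_le (K := K) hf φ p f hf'
  have := hR φ
  omega

theorem aux_step [HasFiniteBiproducts C] (hf : ∀ X Y : C, FiniteDimensional K (X ⟶ Y)) {M N : C}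
    (hR : ∀ {X Y : C} (φ : X ⟶ Y), finrank K (LinearMap.range (Linear.leftComp K M φ)) =
      finrank K (LinearMap.range (Linear.leftComp K N φ)))
    (f : M ⟶ N) (p : N ⟶ M) (hf' : f ≫ p ≫ f = f) (hp : p ≫ f ≫ p = p) (hne : f ≫ p ≠ 𝟙 M) :
    ∃ (x : M ⟶ N) (y : N ⟶ M), ¬ IsNilpotent (R := CategoryTheory.End M)
      ((𝟙 M - f ≫ p) ≫ x ≫ (𝟙 N - p ≫ f) ≫ y) := by
  by_contra! hnil
  set P := 𝟙 M - f ≫ p with hP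
  set Q := 𝟙 N - p ≫ f with hQ
  have hPP : P ≫ P = P := by simp [hP, hp]
  have hQQ : Q ≫ Q = Q := by simp [hQ, hf']
  let β := Module.finBasis K (M ⟶ N)
  let φ : M ⟶ ⨁ (fun _ : Fin (finrank K (M ⟶ N)) => N) := biproduct.lift (fun i => β i ≫ Q)
  have h1 := aux_compl (K := K) hf hR f p hf' hp φ
  have h2 := aux_compl (K := K) hf hR f p hf' hp (𝟙 M)
  rw [← hP, ← hQ] at h1 h2
  have h3 : LinearMap.range (Linear.rightComp K M Q ∘ₗ Linear.leftComp K N (𝟙 M)) ≤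
      LinearMap.range (Linear.rightComp K M Q ∘ₗ Linear.leftComp K N φ) := by
    rintro _ ⟨x, rfl⟩
    simp only [LinearMap.comp_apply, Linear.leftComp_apply, Category.id_comp]
    rw [← β.sum_repr x, map_sum]
    refine Submodule.sum_mem _ fun i _ => ?_
    rw [map_smul]
    refine Submodule.smul_mem _ _ ⟨biproduct.π _ i, ?_⟩
    simp [φ, hQQ]
  have h4 : LinearMap.range (Linear.rightComp K M P ∘ₗ Linear.leftComp K M φ) ≤
      LinearMap.range (Linear.rightComp K M P ∘ₗ Linear.leftComp K M (𝟙 M)) := by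
    rintro _ ⟨x, rfl⟩
    exact ⟨φ ≫ x, by simp⟩
  have h5 := Submodule.eq_of_le_of_finrank_le h4 (by
    rw [h1, h2]; exact Submodule.finrank_mono h3)
  have h6 : P ∈ LinearMap.range (Linear.rightComp K M P ∘ₗ Linear.leftComp K M φ) := by
    rw [h5]; exact ⟨𝟙 M, by simp⟩
  obtain ⟨ψ, hψ⟩ := h6
  have h7 : P = ∑ i, P ≫ β i ≫ Q ≫ (biproduct.ι (fun _ => N) i ≫ ψ ≫ P) := by
    have hψ' : (φ ≫ ψ) ≫ P = P := hψ
    have : φ ≫ ψ = ∑ i, β i ≫ Q ≫ biproduct.ι (fun _ => N) i ≫ ψ := by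
      calc φ ≫ ψ = φ ≫ 𝟙 _ ≫ ψ := by simp
        _ = _ := by
          rw [← biproduct.total, Preadditive.sum_comp, Preadditive.comp_sum]
          simp [φ]
    calc P = P ≫ (φ ≫ ψ) ≫ P := by rw [hψ', hPP]
      _ = _ := by rw [this]; simp [Preadditive.sum_comp, Preadditive.comp_sum]
  obtain ⟨w, hw⟩ := aux_jac (R := CategoryTheory.End M) Finset.univ
    (fun i => (P ≫ β i ≫ Q ≫ (biproduct.ι (fun _ => N) i ≫ ψ ≫ P) : M ⟶ M)) (by
      intro i y
      have := hnil (β i) ((biproduct.ι (fun _ => N) i ≫ ψ ≫ P) ≫ y)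
      simpa [CategoryTheory.End.mul_def] using this)
  have h8 : (𝟙 M - P) ≫ w = 𝟙 M := by
    rw [← h7] at hw
    exact hw
  have h9 : f ≫ p = 𝟙 M - P := by simp [hP]
  apply hne
  have h10 : P = 0 := by
    calc P = P ≫ (𝟙 M - P) ≫ w := by rw [h8, Category.comp_id]
      _ = 0 := by
        rw [← Category.assoc, Preadditive.comp_sub, Category.comp_id, hPP, sub_self, zero_comp]
  rw [h9, h10, sub_zero]

theorem aux_iso [HasFiniteBiproducts C] (hf : ∀ X Y : C, FiniteDimensional K (X ⟶ Y)) {M N : C}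
    (hR : ∀ {X Y : C} (φ : X ⟶ Y), finrank K (LinearMap.range (Linear.leftComp K M φ)) =
      finrank K (LinearMap.range (Linear.leftComp K N φ))) : Nonempty (M ≅ N) := by
  let S : Set (Submodule K (M ⟶ M)) :=
    {U | ∃ (f : M ⟶ N) (p : N ⟶ M), f ≫ p ≫ f = f ∧ p ≫ f ≫ p = p ∧
      U = LinearMap.range (Linear.rightComp K M (f ≫ p))}
  have hS : S.Nonempty := ⟨_, 0, 0, by simp, by simp, rfl⟩
  obtain ⟨U, ⟨f, p, hfp, hpf, rfl⟩, hmax⟩ :=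
    (wellFounded_gt (α := Submodule K (M ⟶ M))).has_min S hS
  have he : f ≫ p = 𝟙 M := by
    by_contra hne
    obtain ⟨x, y, hxy⟩ := aux_step (K := K) hf hR f p hfp hpf hne
    set P := 𝟙 M - f ≫ p with hP
    set Q := 𝟙 N - p ≫ f with hQ
    have hPP : P ≫ P = P := by simp [hP, hpf]
    have hQQ : Q ≫ Q = Q := by simp [hQ, hfp]
    have hPf : P ≫ f = 0 := by simp [hP, hfp]
    have hfQ : f ≫ Q = 0 := by simp [hQ, hfp]
    have hpP : p ≫ P = 0 := by simp [hP, hpf]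
    have hQp : Q ≫ p = 0 := by simp [hQ, hpf]
    have : FiniteDimensional K (CategoryTheory.End M) := hf M M
    obtain ⟨w, hw1, hw2, hw3⟩ := aux_idem (K := K) (R := CategoryTheory.End M) _ hxy
    obtain ⟨t, ht⟩ : ∃ t : M ⟶ M, t = P ≫ x ≫ Q ≫ y := ⟨_, rfl⟩
    rw [← ht] at hw1 hw2 hw3
    obtain ⟨ε, hε⟩ : ∃ ε : M ⟶ M, ε = t ≫ w := ⟨_, rfl⟩
    have hw1' : w ≫ t = t ≫ w := hw1
    have hw2' : ε ≫ ε = ε := by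
      rw [hε, ← hw1']; exact hw2
    have hw3' : ε ≠ 0 := by
      rw [hε, ← hw1']; exact hw3
    have hPε : P ≫ ε = ε := by rw [hε, ht]; simp [reassoc_of% hPP]
    obtain ⟨f1, hf1⟩ : ∃ f1 : M ⟶ N, f1 = ε ≫ P ≫ x ≫ Q := ⟨_, rfl⟩
    obtain ⟨p1, hp1⟩ : ∃ p1 : N ⟶ M, p1 = Q ≫ y ≫ w ≫ ε ≫ P := ⟨_, rfl⟩
    have h11 : f1 ≫ p1 = ε ≫ P := by
      have : f1 ≫ p1 = ε ≫ (t ≫ w) ≫ ε ≫ P := by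
        rw [hf1, hp1, ht]; simp [reassoc_of% hQQ]
      rw [this, ← hε, reassoc_of% hw2', reassoc_of% hw2']
    have h12 : f1 ≫ p1 ≫ f1 = f1 := by
      rw [reassoc_of% h11, hf1, reassoc_of% hPε, reassoc_of% hw2']
    have h13 : p1 ≫ f1 ≫ p1 = p1 := by
      rw [h11, hp1]; simp only [Category.assoc]; rw [reassoc_of% hPε, reassoc_of% hw2']
    have o1 : f ≫ p1 = 0 := by rw [hp1, reassoc_of% hfQ, zero_comp]
    have o2 : f1 ≫ p = 0 := by rw [hf1]; simp [hQp]
    have o3 : p ≫ f1 = 0 := by rw [hf1, ← reassoc_of% hPε, reassoc_of% hpP, zero_comp]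
    have o4 : p1 ≫ f = 0 := by rw [hp1]; simp [hPf]
    have hnew : (f + f1) ≫ (p + p1) = f ≫ p + f1 ≫ p1 := by simp [o1, o2]
    refine hmax (LinearMap.range (Linear.rightComp K M ((f + f1) ≫ (p + p1))))
      ⟨f + f1, p + p1, ?_, ?_, rfl⟩ ?_
    · rw [reassoc_of% hnew]; simp [hfp, h12, o3, o4]
    · rw [hnew]; simp [hpf, h13, reassoc_of% o3, reassoc_of% o4]
    · rw [hnew]
      refine lt_of_le_of_ne ?_ ?_
      · rintro _ ⟨a, rfl⟩
        refine ⟨a ≫ f ≫ p, ?_⟩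
        simp [hpf, reassoc_of% o3]
      · intro heq
        have : f1 ≫ p1 ∈ LinearMap.range (Linear.rightComp K M (f ≫ p)) := by
          rw [heq]
          refine ⟨f1 ≫ p1, ?_⟩
          simp [h13, reassoc_of% o4]
        obtain ⟨a, ha⟩ := this
        have ha : a ≫ f ≫ p = f1 ≫ p1 := ha
        have h0 : f1 ≫ p1 = 0 := by
          calc f1 ≫ p1 = (f1 ≫ p1) ≫ f1 ≫ p1 := by simp [h13]
            _ = (a ≫ f ≫ p) ≫ f1 ≫ p1 := by rw [ha]
            _ = 0 := by simp [reassoc_of% o3]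
        apply hw3'
        rw [← hw2']
        nth_rw 2 [← hPε]
        rw [← reassoc_of% h11, reassoc_of% h0, zero_comp]
  have h1 := aux_compl (K := K) hf hR f p hfp hpf (𝟙 N)
  have h2 : Linear.rightComp K N (𝟙 M - f ≫ p) ∘ₗ Linear.leftComp K M (𝟙 N) = 0 := by
    ext a; simp [he]
  rw [h2, LinearMap.range_zero, finrank_bot] at h1
  have h3 := Submodule.finrank_eq_zero.1 h1.symm
  rw [LinearMap.range_eq_bot] at h3
  have h4 : (𝟙 N - p ≫ f) = 0 := by
    have := LinearMap.congr_fun h3 (𝟙 N)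
    simpa using this
  exact ⟨⟨f, p, he, (sub_eq_zero.1 h4).symm⟩⟩

end Cat

section Tri
open Module
universe v u w
variable {K : Type w} [Field K] {T : Type u} [Category.{v} T] [Preadditive T] [Linear K T]
    [HasZeroObject T] [HasShift T ℤ] [∀ n : ℤ, (shiftFunctor T n).Additive]

theorem aux_findim
    (hfin : ∀ A B : T, FiniteDimensional K (DirectSum ℤ (fun k : ℤ => A ⟶ B⟦k⟧))) (A B : T) :
    FiniteDimensional K (A ⟶ B) := by
  classical
  have := hfin A B
  let i := (shiftFunctorZero T ℤ).app B
  refine FiniteDimensional.of_injective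
    (DirectSum.lof K ℤ (fun k : ℤ => A ⟶ B⟦k⟧) 0 ∘ₗ Linear.rightComp K A i.inv) ?_
  intro a b hab
  have hab : a ≫ i.inv = b ≫ i.inv := DirectSum.of_injective (β := fun k : ℤ => A ⟶ B⟦k⟧) 0 hab
  exact (cancel_mono i.inv).1 hab

theorem aux_vanish
    (hfin : ∀ A B : T, FiniteDimensional K (DirectSum ℤ (fun k : ℤ => A ⟶ B⟦k⟧))) (A B : T) :
    ∃ n₀ : ℕ, ∀ n : ℕ, n₀ ≤ n → ∀ g : A ⟶ B⟦(-(n : ℤ))⟧, g = 0 := by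
  classical
  obtain ⟨s, hs⟩ := (hfin A B).fg_top
  let F : Finset ℤ := s.biUnion (fun x => DFinsupp.support x)
  have hF : ∀ k, k ∉ F → ∀ g : A ⟶ B⟦k⟧, g = 0 := by
    intro k hk g
    have h1 : Submodule.span K (s : Set (DirectSum ℤ (fun k : ℤ => A ⟶ B⟦k⟧))) ≤
        LinearMap.ker (DirectSum.component K ℤ (fun k : ℤ => A ⟶ B⟦k⟧) k) := by
      rw [Submodule.span_le]
      intro x hx
      have : k ∉ DFinsupp.support x := fun h => hk (Finset.mem_biUnion.2 ⟨x, hx, h⟩)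
      have h0 : x k = 0 := by simpa using this
      exact h0
    rw [hs] at h1
    have h2 : DirectSum.lof K ℤ (fun k : ℤ => A ⟶ B⟦k⟧) k g ∈
      LinearMap.ker (DirectSum.component K ℤ (fun k : ℤ => A ⟶ B⟦k⟧) k) := h1 trivial
    rw [LinearMap.mem_ker, DirectSum.component.lof_self] at h2
    exact h2
  refine ⟨(F.sup Int.natAbs) + 1, fun n hn g => hF _ (fun hmem => ?_) g⟩
  have := Finset.le_sup (f := Int.natAbs) hmem
  simp at this
  omega

variable [Pretriangulated T]

theorem aux_rank_cone (hf : ∀ X Y : T, FiniteDimensional K (X ⟶ Y)) {X Y C : T} {φ : X ⟶ Y}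
    {γ : Y ⟶ C} {η : C ⟶ X⟦(1 : ℤ)⟧} (hT : Triangle.mk φ γ η ∈ distTriang T) (Z : T) :
    finrank K (C ⟶ Z) + finrank K (LinearMap.range (Linear.leftComp K Z φ)) +
      finrank K (LinearMap.range (Linear.leftComp K Z (φ⟦(1 : ℤ)⟧'))) =
    finrank K (Y ⟶ Z) + finrank K (X⟦(1 : ℤ)⟧ ⟶ Z) := by
  have z1 : φ ≫ γ = 0 := comp_distTriang_mor_zero₁₂ _ hT
  have z2 : γ ≫ η = 0 := comp_distTriang_mor_zero₂₃ _ hT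
  have z3 : η ≫ φ⟦(1 : ℤ)⟧' = 0 := comp_distTriang_mor_zero₃₁ _ hT
  have e1 : LinearMap.range (Linear.leftComp K Z γ) = LinearMap.ker (Linear.leftComp K Z φ) := by
    ext x
    constructor
    · rintro ⟨y, rfl⟩
      simp [reassoc_of% z1]
    · intro hx
      obtain ⟨y, hy⟩ := Triangle.yoneda_exact₂ _ hT x hx
      exact ⟨y, hy.symm⟩
  have e2 : LinearMap.range (Linear.leftComp K Z η) = LinearMap.ker (Linear.leftComp K Z γ) := by
    ext x
    constructor
    · rintro ⟨y, rfl⟩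
      simp [reassoc_of% z2]
    · intro hx
      obtain ⟨y, hy⟩ := Triangle.yoneda_exact₃ _ hT x hx
      exact ⟨y, hy.symm⟩
  have e3 : LinearMap.range (Linear.leftComp K Z (φ⟦(1 : ℤ)⟧')) =
      LinearMap.ker (Linear.leftComp K Z η) := by
    ext x
    constructor
    · rintro ⟨y, rfl⟩
      simp [reassoc_of% z3]
    · intro hx
      obtain ⟨y, hy⟩ : ∃ y : Y⟦(1 : ℤ)⟧ ⟶ Z, x = (-(φ⟦(1 : ℤ)⟧')) ≫ y :=
        Triangle.yoneda_exact₃ _ (rot_of_distTriang _ hT) x hx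
      exact ⟨-y, by rw [hy]; simp⟩
  have r1 := LinearMap.finrank_range_add_finrank_ker (Linear.leftComp K Z φ)
  have r2 := LinearMap.finrank_range_add_finrank_ker (Linear.leftComp K Z γ)
  have r3 := LinearMap.finrank_range_add_finrank_ker (Linear.leftComp K Z η)
  rw [← e1] at r1
  rw [← e2] at r2
  rw [← e3] at r3
  omega

theorem aux_shift_zero {X M : T} (n : ℕ) (h : ∀ g : X ⟶ M⟦(-((n + 1 : ℕ) : ℤ))⟧, g = 0)
    (g : X⟦(1 : ℤ)⟧ ⟶ M⟦(-(n : ℤ))⟧) : g = 0 := by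
  let adj := (shiftEquiv T (1 : ℤ)).toAdjunction
  apply (adj.homEquiv X _).injective
  let i := (shiftFunctorAdd' T (-(n : ℤ)) (-1) (-((n + 1 : ℕ) : ℤ)) (by push_cast; ring)).app M
  have key : ∀ a : X ⟶ (M⟦(-(n : ℤ))⟧)⟦(-1 : ℤ)⟧, a = 0 := by
    intro a
    have : a ≫ i.inv = 0 := h _
    rw [← cancel_mono i.inv, zero_comp]
    exact this
  exact (key _).trans (key _).symm

theorem aux_rank (hf : ∀ X Y : T, FiniteDimensional K (X ⟶ Y)) {M N : T}
    (hMN : ∀ X : T, finrank K (X ⟶ M) = finrank K (X ⟶ N)) (n : ℕ) :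
    ∀ {X Y : T} (φ : X ⟶ Y), (∀ g : X ⟶ M⟦(-(n : ℤ))⟧, g = 0) →
      (∀ g : X ⟶ N⟦(-(n : ℤ))⟧, g = 0) →
      finrank K (LinearMap.range (Linear.leftComp K M φ)) =
      finrank K (LinearMap.range (Linear.leftComp K N φ)) := by
  induction n with
  | zero =>
    intro X Y φ h1 h2
    have key : ∀ Z : T, (∀ g : X ⟶ Z⟦(-((0 : ℕ) : ℤ))⟧, g = 0) →
        finrank K (LinearMap.range (Linear.leftComp K Z φ)) = 0 := by
      intro Z hZ
      let i := (shiftFunctorZero' T (-((0 : ℕ) : ℤ)) (by simp)).app Z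
      have : Linear.leftComp K Z φ = 0 := by
        ext a
        have : (φ ≫ a) ≫ i.inv = 0 := hZ _
        rw [← cancel_mono i.inv]
        simpa using this
      rw [this, LinearMap.range_zero, finrank_bot]
    rw [key M h1, key N h2]
  | succ n ih =>
    intro X Y φ h1 h2
    obtain ⟨C, γ, η, hT⟩ := distinguished_cocone_triangle φ
    have a1 := aux_rank_cone (K := K) hf hT M
    have a2 := aux_rank_cone (K := K) hf hT N
    have a3 := ih (φ⟦(1 : ℤ)⟧') (aux_shift_zero n h1) (aux_shift_zero n h2)
    have := hMN C
    have := hMN Y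
    have := hMN (X⟦(1 : ℤ)⟧)
    omega

/-- Objects are determined by the dimensions of the Hom spaces into them. -/
theorem aux_bongartz
    (hfin : ∀ A B : T, FiniteDimensional K (DirectSum ℤ (fun k : ℤ => A ⟶ B⟦k⟧))) {M N : T}
    (hMN : ∀ X : T, finrank K (X ⟶ M) = finrank K (X ⟶ N)) : Nonempty (M ≅ N) := by
  have hf := aux_findim hfin
  refine aux_iso (K := K) hf ?_
  intro X Y φ
  obtain ⟨n1, h1⟩ := aux_vanish hfin X M
  obtain ⟨n2, h2⟩ := aux_vanish hfin X N
  exact aux_rank hf hMN (max n1 n2) φ (h1 _ (le_max_left _ _)) (h2 _ (le_max_right _ _))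

/-- Exactness of `Hom(X, -)` on a distinguished triangle, in the range needed. -/
theorem aux_exact {A B C : T} {f : A ⟶ B} {g : B ⟶ C} {h : C ⟶ A⟦(1 : ℤ)⟧}
    (hT : Triangle.mk f g h ∈ distTriang T) (X : T) :
    LinearMap.range (Linear.rightComp K X f) = LinearMap.ker (Linear.rightComp K X g) ∧
    LinearMap.range (Linear.rightComp K X g) = LinearMap.ker (Linear.rightComp K X h) ∧
    LinearMap.range (Linear.rightComp K X h) =
      LinearMap.ker (Linear.rightComp K X (f⟦(1 : ℤ)⟧')) ∧
    LinearMap.range (Linear.rightComp K X (f⟦(1 : ℤ)⟧')) =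
      LinearMap.ker (Linear.rightComp K X (g⟦(1 : ℤ)⟧')) ∧
    LinearMap.range (Linear.rightComp K X (g⟦(1 : ℤ)⟧')) =
      LinearMap.ker (Linear.rightComp K X (h⟦(1 : ℤ)⟧')) := by
  have z1 : f ≫ g = 0 := comp_distTriang_mor_zero₁₂ _ hT
  have z2 : g ≫ h = 0 := comp_distTriang_mor_zero₂₃ _ hT
  have z3 : h ≫ f⟦(1 : ℤ)⟧' = 0 := comp_distTriang_mor_zero₃₁ _ hT
  have z4 : f⟦(1 : ℤ)⟧' ≫ g⟦(1 : ℤ)⟧' = 0 := by rw [← Functor.map_comp, z1, Functor.map_zero]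
  have z5 : g⟦(1 : ℤ)⟧' ≫ h⟦(1 : ℤ)⟧' = 0 := by rw [← Functor.map_comp, z2, Functor.map_zero]
  have gen : ∀ {P Q R : T} (a : P ⟶ Q) (b : Q ⟶ R), a ≫ b = 0 →
      (∀ x : X ⟶ Q, x ≫ b = 0 → ∃ y, x = y ≫ a) →
      LinearMap.range (Linear.rightComp K X a) = LinearMap.ker (Linear.rightComp K X b) := by
    intro P Q R a b hab hex
    ext x
    constructor
    · rintro ⟨y, rfl⟩
      simp [hab]
    · intro hx
      obtain ⟨y, hy⟩ := hex x hx
      exact ⟨y, hy.symm⟩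
  have hr := rot_of_distTriang _ hT
  have hrr := rot_of_distTriang _ hr
  refine ⟨gen _ _ z1 (Triangle.coyoneda_exact₂ _ hT), gen _ _ z2 (Triangle.coyoneda_exact₃ _ hT),
    gen _ _ z3 (Triangle.coyoneda_exact₁ _ hT), gen _ _ z4 ?_, gen _ _ z5 ?_⟩
  · intro x hx
    obtain ⟨y, hy⟩ : ∃ y : X ⟶ A⟦(1 : ℤ)⟧, x = y ≫ (-(f⟦(1 : ℤ)⟧')) :=
      Triangle.coyoneda_exact₁ _ hr x hx
    exact ⟨-y, by rw [hy]; simp⟩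
  · intro x hx
    obtain ⟨y, hy⟩ : ∃ y : X ⟶ B⟦(1 : ℤ)⟧, x = y ≫ (-(g⟦(1 : ℤ)⟧')) :=
      Triangle.coyoneda_exact₁ _ hrr x hx
    exact ⟨-y, by rw [hy]; simp⟩

theorem aux_dim (hf : ∀ X Y : T, FiniteDimensional K (X ⟶ Y))
    {A B C B' C' D D' : T}
    {f : A ⟶ B} {g : B ⟶ C} {h : C ⟶ A⟦(1 : ℤ)⟧}
    {f' : A ⟶ B'} {g' : B' ⟶ C'} {h' : C' ⟶ A⟦(1 : ℤ)⟧}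
    (hT : Triangle.mk f g h ∈ distTriang T)
    (hT' : Triangle.mk f' g' h' ∈ distTriang T)
    {b : B ⟶ B'} {c : C ⟶ C'}
    (hb : f ≫ b = f') (hbc : g ≫ c = b ≫ g') (hc : c ≫ h' = h)
    {u : B' ⟶ D} {v : D ⟶ B⟦(1 : ℤ)⟧}
    (hD : Triangle.mk b u v ∈ distTriang T)
    {u' : C' ⟶ D'} {v' : D' ⟶ C⟦(1 : ℤ)⟧}
    (hD' : Triangle.mk c u' v' ∈ distTriang T) (X : T) :
    finrank K (X ⟶ D) = finrank K (X ⟶ D') := by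
  obtain ⟨t1, t2, t3, t4, t5⟩ := aux_exact (K := K) hT X
  obtain ⟨t1', t2', t3', t4', t5'⟩ := aux_exact (K := K) hT' X
  obtain ⟨d1, d2, d3, -, -⟩ := aux_exact (K := K) hD X
  obtain ⟨d1', d2', d3', -, -⟩ := aux_exact (K := K) hD' X
  have comp : ∀ {P Q R : T} (a : P ⟶ Q) (b : Q ⟶ R) (c : P ⟶ R), a ≫ b = c →
      Linear.rightComp K X b ∘ₗ Linear.rightComp K X a = Linear.rightComp K X c := by
    intro P Q R a b c habc
    ext x
    simp [← habc]
  have l0 := aux_ladder _ _ _ _ _ _ (Linear.rightComp K X b) (Linear.rightComp K X c) t2 t1'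
    (comp _ _ _ hb) ((comp _ _ _ hbc).trans (comp _ _ _ rfl).symm) (comp _ _ _ hc)
  have l1 := aux_ladder _ _ _ _ _ _ (Linear.rightComp K X (b⟦(1 : ℤ)⟧'))
    (Linear.rightComp K X (c⟦(1 : ℤ)⟧')) t5 t4'
    (comp _ _ _ (by rw [← Functor.map_comp, hb]))
    ((comp _ _ _ (by rw [← Functor.map_comp, hbc, Functor.map_comp])).trans (comp _ _ _ rfl).symm)
    (comp _ _ _ (by rw [← Functor.map_comp, hc]))
  have rn : ∀ {P Q : T} (a : P ⟶ Q), _ := fun a =>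
    LinearMap.finrank_range_add_finrank_ker (Linear.rightComp K X a)
  have a1 := rn h'
  have a2 := rn g'
  have a3 := rn (h⟦(1 : ℤ)⟧')
  have a4 := rn (g⟦(1 : ℤ)⟧')
  have a5 := rn (f⟦(1 : ℤ)⟧')
  have a6 := rn (f'⟦(1 : ℤ)⟧')
  have b1 := rn u
  have b2 := rn v
  have b3 := rn (b⟦(1 : ℤ)⟧')
  have c1 := rn u'
  have c2 := rn v'
  have c3 := rn (c⟦(1 : ℤ)⟧')
  rw [← t2'] at a1
  rw [← t1'] at a2
  rw [← t5] at a3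
  rw [← t4] at a4
  rw [← t3] at a5
  rw [← t3'] at a6
  rw [← d1] at b1
  rw [← d2] at b2
  rw [← d3] at b3
  rw [← d1'] at c1
  rw [← d2'] at c2
  rw [← d3'] at c3
  omega

end Tri


/-- **Proposition (cone!).** In a `K`-linear triangulated category whose total Hom-spaces
`⊕ₖ Hom(A, B⟦k⟧)` are finite dimensional, given a morphism of distinguished triangles of the
form `(𝟙 A, b, c)`, any cone of `c` is isomorphic to any cone of `b`. -/
theorem cone_iso_of_triangle_hom_id
    {K : Type*} [Field K] {T : Type*} [Category T] [Preadditive T] [Linear K T]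
    [HasZeroObject T] [HasShift T ℤ] [∀ n : ℤ, (shiftFunctor T n).Additive]
    [∀ n : ℤ, (shiftFunctor T n).Linear K] [Pretriangulated T]
    (hfin : ∀ A B : T, FiniteDimensional K (DirectSum ℤ (fun k : ℤ => A ⟶ B⟦k⟧)))
    {A B C B' C' D D' : T}
    {f : A ⟶ B} {g : B ⟶ C} {h : C ⟶ A⟦(1 : ℤ)⟧}
    {f' : A ⟶ B'} {g' : B' ⟶ C'} {h' : C' ⟶ A⟦(1 : ℤ)⟧}
    (hT : Triangle.mk f g h ∈ distTriang T)
    (hT' : Triangle.mk f' g' h' ∈ distTriang T)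
    {b : B ⟶ B'} {c : C ⟶ C'}
    (hb : f ≫ b = f') (hbc : g ≫ c = b ≫ g') (hc : c ≫ h' = h)
    {u : B' ⟶ D} {v : D ⟶ B⟦(1 : ℤ)⟧}
    (hD : Triangle.mk b u v ∈ distTriang T)
    {u' : C' ⟶ D'} {v' : D' ⟶ C⟦(1 : ℤ)⟧}
    (hD' : Triangle.mk c u' v' ∈ distTriang T) :
    Nonempty (D ≅ D') := by
  exact aux_bongartz hfin (aux_dim (aux_findim hfin) hT hT' hb hbc hc hD hD')
end

section
/- Let K be a field and T a K-linear triangulated category such that for all objects A, B of T the K-vector space ⊕_{k∈ℤ} Hom_T(A, B[k]) is finite-dimensional. Let (E_0, …, E_m) be a full exceptional sequence in T. Then there exist objects E'_0, …, E'_m of T such that: (i) (E'_m, E'_{m-1}, …, E'_0) is a full exceptional sequence in T; (ii) E'_0 ≅ E_0; and (iii) for all 0 ≤ i, j ≤ m and all k ∈ ℤ, the K-vector space Hom_T(E_i, E'_j[k]) is 1-dimensional if i = j and k = 0, and is zero otherwise. -/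
open CategoryTheory CategoryTheory.Limits CategoryTheory.Pretriangulated

section

variable {T : Type*} [Category T] [Preadditive T] [HasZeroObject T] [HasShift T ℤ]
  [∀ n : ℤ, (shiftFunctor T n).Additive] [Pretriangulated T]

/-- Membership in the smallest strictly full triangulated subcategory of `T`
containing a class of objects `S`. -/
inductive GenSub (S : Set T) : T → Prop
  | of (X : T) (hX : X ∈ S) : GenSub S X
  | zero (X : T) (hX : IsZero X) : GenSub S X
  | isoClosed {X Y : T} (e : X ≅ Y) (hX : GenSub S X) : GenSub S Y
  | shift (X : T) (n : ℤ) (hX : GenSub S X) : GenSub S (X⟦n⟧)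
  | ext (Tr : Triangle T) (hTr : Tr ∈ distTriang T) (h₁ : GenSub S Tr.obj₁)
      (h₂ : GenSub S Tr.obj₂) : GenSub S Tr.obj₃

end

/-- An object `E` of a `K`-linear triangulated category is exceptional if `Hom(E, E)` is
one-dimensional over `K` and `Hom(E, E⟦k⟧) = 0` for all `k ≠ 0`. -/
def IsExceptional (K : Type*) [Field K] {T : Type*} [Category T] [Preadditive T]
    [Linear K T] [HasShift T ℤ] (E : T) : Prop :=
  Module.finrank K (E ⟶ E) = 1 ∧ ∀ k : ℤ, k ≠ 0 → ∀ φ : E ⟶ E⟦k⟧, φ = 0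

section

variable {K : Type*} [Field K] {T : Type*} [Category T] [Preadditive T]
    [HasZeroObject T] [HasShift T ℤ] [∀ n : ℤ, (shiftFunctor T n).Additive]
    [Pretriangulated T]

def Orth (A B : T) : Prop := ∀ (k : ℤ) (φ : A ⟶ B⟦k⟧), φ = 0

lemma eq_zero_of_comp_iso {A B C : T} (e : B ≅ C) (h : ∀ φ : A ⟶ C, φ = 0) (φ : A ⟶ B) :
    φ = 0 := by
  rw [← cancel_mono e.hom, zero_comp]; exact h _

lemma Orth.zero {A B : T} (h : Orth A B) (φ : A ⟶ B) : φ = 0 :=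
  eq_zero_of_comp_iso ((shiftFunctorZero T ℤ).app B).symm (h 0) φ

lemma Orth.shift_right {A B : T} (h : Orth A B) (n : ℤ) : Orth A (B⟦n⟧) := fun k =>
  eq_zero_of_comp_iso ((shiftFunctorAdd T n k).app B).symm (h (n + k))

lemma Orth.shift_left {A B : T} (h : Orth A B) (n : ℤ) : Orth (A⟦n⟧) B := by
  intro k φ
  apply (shiftFunctor T (-n)).map_injective
  rw [Functor.map_zero]
  rw [← cancel_epi ((shiftShiftNeg A n).inv), comp_zero]
  exact (h.shift_right k) (-n) _

lemma ex2 (t : Triangle T) (ht : t ∈ distTriang T) (n : ℤ) {W : T} (f : W ⟶ t.obj₂⟦n⟧)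
    (hf : f ≫ t.mor₂⟦n⟧' = 0) : ∃ g : W ⟶ t.obj₁⟦n⟧, f = g ≫ t.mor₁⟦n⟧' := by
  obtain ⟨g, hg⟩ : ∃ g : W ⟶ t.obj₁⟦n⟧, f = g ≫ (n.negOnePow • t.mor₁⟦n⟧') :=
    Triangle.coyoneda_exact₂ _ (Triangle.shift_distinguished t ht n) f
    (by
      change f ≫ (n.negOnePow • t.mor₂⟦n⟧') = 0
      rw [Linear.comp_units_smul, hf, smul_zero])
  refine ⟨n.negOnePow • g, ?_⟩
  rw [hg, Linear.comp_units_smul, Linear.units_smul_comp]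

lemma ex3 (t : Triangle T) (ht : t ∈ distTriang T) (n : ℤ) {W : T} (f : W ⟶ t.obj₃⟦n⟧)
    (hf : f ≫ t.mor₃⟦n⟧' = 0) : ∃ g : W ⟶ t.obj₂⟦n⟧, f = g ≫ t.mor₂⟦n⟧' :=
  ex2 t.rotate (rot_of_distTriang _ ht) n f hf

structure Good (P : Set T) {X Y : T} (f : X ⟶ Y) : Prop where
  pre : ∀ Z, (∀ e ∈ P, Orth e Z) → Function.Bijective (fun g : Y ⟶ Z => f ≫ g)
  post : ∀ W, (∀ e ∈ P, Orth W e) → ∀ k : ℤ,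
    Function.Bijective (fun g : W ⟶ X⟦k⟧ => g ≫ f⟦k⟧')
  gen : ∀ S : Set T, (∀ e ∈ P, GenSub S e) → (GenSub S X ↔ GenSub S Y)

lemma Good.id (P : Set T) (X : T) : Good P (𝟙 X) where
  pre Z _ := by simp only [Category.id_comp, CategoryTheory.Functor.map_id, Category.comp_id]; exact Function.bijective_id
  post W _ k := by simp only [Category.id_comp, CategoryTheory.Functor.map_id, Category.comp_id]; exact Function.bijective_id
  gen S _ := Iff.rfl

lemma Good.comp {P : Set T} {X Y Z : T} {f : X ⟶ Y} {g : Y ⟶ Z} (hf : Good P f) (hg : Good P g) :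
    Good P (f ≫ g) where
  pre V h := by
    have := (hf.pre V h).comp (hg.pre V h)
    simpa [Function.comp_def] using this
  post W h k := by
    have := (hg.post W h k).comp (hf.post W h k)
    simpa [Function.comp_def] using this
  gen S h := (hf.gen S h).trans (hg.gen S h)

lemma Good.mono {P Q : Set T} (hPQ : P ⊆ Q) {X Y : T} {f : X ⟶ Y} (hf : Good P f) : Good Q f where
  pre V h := hf.pre V (fun e he => h e (hPQ he))
  post W h k := hf.post W (fun e he => h e (hPQ he)) k
  gen S h := hf.gen S (fun e he => h e (hPQ he))

lemma bij_of {A B : Type*} [AddCommGroup A] [AddCommGroup B] (f : A →+ B)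
    (h1 : ∀ a, f a = 0 → a = 0) (h2 : Function.Surjective f) : Function.Bijective f :=
  ⟨(injective_iff_map_eq_zero f).2 h1, h2⟩

lemma GenSub.trans {S S' : Set T} (h : ∀ X ∈ S, GenSub S' X) {X : T} (hX : GenSub S X) :
    GenSub S' X := by
  induction hX with
  | of X hX => exact h X hX
  | zero X hX => exact .zero X hX
  | isoClosed e _ ih => exact .isoClosed e ih
  | shift X n _ ih => exact .shift X n ih
  | ext t ht _ _ h1 h2 => exact .ext t ht h1 h2

lemma good_of_cone {E : T} (k : ℤ) (t : Triangle T) (ht : t ∈ distTriang T)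
    (h1 : t.obj₁ = E⟦k⟧) : Good {E} t.mor₂ where
  pre Z hZ := by
    have hE : Orth t.obj₁ Z := by rw [h1]; exact (hZ E rfl).shift_left k
    refine bij_of (Preadditive.leftComp Z t.mor₂) (fun a ha => ?_) (fun b => ?_)
    · obtain ⟨g, rfl⟩ := Triangle.yoneda_exact₃ t ht a ha
      rw [(hE.shift_left 1).zero g, comp_zero]
    · obtain ⟨g, hg⟩ := Triangle.yoneda_exact₂ t ht b (hE.zero _)
      exact ⟨g, hg.symm⟩
  post W hW l := by
    have hE : Orth W t.obj₁ := by rw [h1]; exact (hW E rfl).shift_right k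
    refine bij_of (Preadditive.rightComp W (t.mor₂⟦l⟧')) (fun a ha => ?_) (fun b => ?_)
    · obtain ⟨g, rfl⟩ := ex2 t ht l a ha
      rw [hE l g, zero_comp]
    · obtain ⟨g, hg⟩ := ex3 t ht l b (hE.shift_right 1 l _)
      exact ⟨g, hg.symm⟩
  gen S hS := by
    have hE : GenSub S t.obj₁ := by rw [h1]; exact (hS E rfl).shift _ k
    refine ⟨fun h => .ext t ht hE h, fun h => ?_⟩
    refine .ext _ (inv_rot_of_distTriang t ht) ?_ hE
    exact h.shift _ (-1)

variable [Linear K T] [∀ n : ℤ, (shiftFunctor T n).Linear K]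

lemma step {E X : T} (hE : IsExceptional K E)
    (hfin : ∀ A B : T, FiniteDimensional K (DirectSum ℤ (fun k : ℤ => A ⟶ B⟦k⟧)))
    (hX : ¬ Orth E X) : ∃ (Y : T) (f : X ⟶ Y), Good {E} f ∧
      Module.finrank K (DirectSum ℤ (fun k : ℤ => E ⟶ Y⟦k⟧)) <
      Module.finrank K (DirectSum ℤ (fun k : ℤ => E ⟶ X⟦k⟧)) := by
  unfold Orth at hX
  push Not at hX
  obtain ⟨k, φ, hφ⟩ := hX
  obtain ⟨e⟩ : Nonempty (E ≅ (E⟦-k⟧)⟦k⟧) := ⟨(shiftNegShift E k).symm⟩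
  obtain ⟨ψ, hψ⟩ := (shiftFunctor T k).map_surjective (e.inv ≫ φ)
  have hφ' : φ = e.hom ≫ ψ⟦k⟧' := by rw [hψ]; simp
  obtain ⟨Y, f, δ, ht⟩ := distinguished_cocone_triangle ψ
  -- Homs from `E` to shifts of `E⟦-k⟧`
  have hD0 : ∀ l : ℤ, l ≠ k → ∀ g : E ⟶ (E⟦-k⟧)⟦l⟧, g = 0 := fun l hl =>
    eq_zero_of_comp_iso ((shiftFunctorAdd T (-k) l).app E).symm (hE.2 (-k + l) (by omega))
  have hEnd : ∀ g : E ⟶ E, ∃ c : K, g = c • 𝟙 E := by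
    intro g
    have hne : (𝟙 E) ≠ 0 := by
      intro h
      apply hφ
      rw [← Category.id_comp φ, h, zero_comp]
    obtain ⟨c, hc⟩ := (finrank_eq_one_iff_of_nonzero' _ hne).1 hE.1 g
    exact ⟨c, hc.symm⟩
  have hinj : ∀ (l : ℤ) (g : E ⟶ (E⟦-k⟧)⟦l⟧), g ≫ ψ⟦l⟧' = 0 → g = 0 := by
    intro l g hg
    by_cases hl : l = k
    · subst hl
      obtain ⟨c, hc⟩ := hEnd (g ≫ e.inv)
      have hg' : g = c • e.hom := by
        rw [← cancel_mono e.inv, hc]; simp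
      rw [hg', Linear.smul_comp, ← hφ'] at hg
      rcases smul_eq_zero.1 hg with h | h
      · rw [hg', h, zero_smul]
      · exact absurd h hφ
    · exact hD0 l hl g
  have hsurj : ∀ l : ℤ, Function.Surjective (Linear.rightComp K E (f⟦l⟧')) := by
    intro l h
    obtain ⟨g, hg⟩ := ex3 _ ht l h (by
      change h ≫ δ⟦l⟧' = 0
      rw [← cancel_mono ((shiftFunctorAdd T 1 l).inv.app (E⟦-k⟧)), zero_comp]
      apply hinj
      have := (shiftFunctorAdd T 1 l).inv.naturality ψ
      rw [Category.assoc, ← this]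
      have h0 : δ ≫ ψ⟦(1 : ℤ)⟧' = 0 := comp_distTriang_mor_zero₃₁ _ ht
      have h1 : δ⟦l⟧' ≫ (ψ⟦(1 : ℤ)⟧')⟦l⟧' = 0 := by
        rw [← Functor.map_comp, h0, Functor.map_zero]
      simp only [Functor.comp_map, Category.assoc]
      rw [reassoc_of% h1]; simp)
    exact ⟨g, hg.symm⟩
  refine ⟨Y, f, good_of_cone (-k) _ ht rfl, ?_⟩
  have := hfin E X
  have := hfin E Y
  let F := DirectSum.lmap (fun l : ℤ => Linear.rightComp K E (f⟦l⟧'))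
  have hF : Function.Surjective F := (DirectSum.lmap_surjective _).2 hsurj
  refine lt_of_le_of_ne (LinearMap.finrank_le_finrank_of_surjective hF) fun heq => hφ ?_
  have hi := (LinearMap.injective_iff_surjective_of_finrank_eq_finrank heq.symm).2 hF
  have hk := (DirectSum.lmap_injective _).1 hi k
  apply hk
  rw [map_zero]
  change φ ≫ f⟦k⟧' = 0
  have h0 : ψ ≫ f = 0 := comp_distTriang_mor_zero₁₂ _ ht
  rw [hφ', Category.assoc, ← Functor.map_comp, h0, Functor.map_zero, comp_zero]

lemma mutate {E : T} (hE : IsExceptional K E)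
    (hfin : ∀ A B : T, FiniteDimensional K (DirectSum ℤ (fun k : ℤ => A ⟶ B⟦k⟧))) (X : T) :
    ∃ (Y : T) (f : X ⟶ Y), Good {E} f ∧ Orth E Y := by
  induction hn : Module.finrank K (DirectSum ℤ (fun k : ℤ => E ⟶ X⟦k⟧))
    using Nat.strong_induction_on generalizing X with
  | _ n ih =>
    by_cases hX : Orth E X
    · exact ⟨X, 𝟙 X, Good.id _ _, hX⟩
    · obtain ⟨Y, f, hf, hlt⟩ := step hE hfin hX
      obtain ⟨Z, g, hg, hZ⟩ := ih _ (hn ▸ hlt) Y rfl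
      exact ⟨Z, f ≫ g, hf.comp hg, hZ⟩

lemma iterMut {m : ℕ} {E : Fin (m + 1) → T} (hexc : ∀ i, IsExceptional K (E i))
    (hfin : ∀ A B : T, FiniteDimensional K (DirectSum ℤ (fun k : ℤ => A ⟶ B⟦k⟧)))
    (hseq : ∀ i j : Fin (m + 1), i < j → Orth (E j) (E i)) (j : Fin (m + 1)) (d : ℕ) :
    ∃ (Y : T) (f : E j ⟶ Y), Good {X | ∃ i, i < j ∧ E i = X} f ∧
      ∀ i : Fin (m + 1), i < j → (j : ℕ) ≤ i + d → Orth (E i) Y := by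
  induction d with
  | zero => exact ⟨E j, 𝟙 _, Good.id _ _, fun i h1 h2 => by
      rw [Fin.lt_def] at h1; omega⟩
  | succ d ih =>
    obtain ⟨Y, f, hf, hY⟩ := ih
    by_cases hd : d + 1 ≤ (j : ℕ)
    · obtain ⟨n, hn⟩ : ∃ n : Fin (m + 1), (n : ℕ) + (d + 1) = j :=
        ⟨⟨j - (d + 1), by omega⟩, by simp; omega⟩
      obtain ⟨Z, g, hg, hZ⟩ := mutate (hexc n) hfin Y
      refine ⟨Z, f ≫ g, hf.comp (hg.mono ?_), fun i h1 h2 => ?_⟩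
      · rintro _ rfl
        exact ⟨n, by rw [Fin.lt_def]; omega, rfl⟩
      · by_cases hi : i = n
        · rw [hi]; exact hZ
        · have hi' : (i : ℕ) ≠ n := fun h => hi (Fin.ext h)
          have hb := hg.post (E i) (by
            rintro _ rfl
            exact hseq n i (by rw [Fin.lt_def]; omega))
          intro k φ
          obtain ⟨a, rfl⟩ := (hb k).2 φ
          dsimp only
          rw [hY i h1 (by omega) k a, zero_comp]
    · exact ⟨Y, f, hf, fun i h1 h2 => hY i h1 (by omega)⟩

end

/-- **Existence of the (right) dual exceptional sequence.** If `(E 0, …, E m)` is a full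
exceptional sequence in a `K`-linear triangulated category with finite-dimensional total
Hom-spaces, then there are objects `E' 0, …, E' m` such that `(E' m, …, E' 0)` is a full
exceptional sequence, `E' 0 ≅ E 0`, and `Hom(E i, (E' j)⟦k⟧)` is one-dimensional when
`i = j` and `k = 0`, and zero otherwise. -/
theorem exists_dual_exceptional_sequence
    {K : Type*} [Field K] {T : Type*} [Category T] [Preadditive T] [Linear K T]
    [HasZeroObject T] [HasShift T ℤ] [∀ n : ℤ, (shiftFunctor T n).Additive]
    [∀ n : ℤ, (shiftFunctor T n).Linear K] [Pretriangulated T]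
    (hfin : ∀ A B : T, FiniteDimensional K (DirectSum ℤ (fun k : ℤ => A ⟶ B⟦k⟧)))
    (m : ℕ) (E : Fin (m + 1) → T)
    (hexc : ∀ i, IsExceptional K (E i))
    (hseq : ∀ i j : Fin (m + 1), i < j → ∀ (k : ℤ) (φ : E j ⟶ (E i)⟦k⟧), φ = 0)
    (hfull : ∀ X : T, GenSub (Set.range E) X) :
    ∃ E' : Fin (m + 1) → T,
      (∀ i, IsExceptional K (E' i)) ∧
      (∀ i j : Fin (m + 1), i < j → ∀ (k : ℤ) (φ : E' i ⟶ (E' j)⟦k⟧), φ = 0) ∧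
      (∀ X : T, GenSub (Set.range E') X) ∧
      Nonempty (E' 0 ≅ E 0) ∧
      (∀ (i j : Fin (m + 1)) (k : ℤ),
        (i = j ∧ k = 0 → Module.finrank K (E i ⟶ (E' j)⟦k⟧) = 1) ∧
        (¬ (i = j ∧ k = 0) → ∀ φ : E i ⟶ (E' j)⟦k⟧, φ = 0)) := by

  choose Y f hf hY using fun j => iterMut hexc hfin hseq j (m + 1)
  have hY' : ∀ i j, i < j → Orth (E i) (Y j) := fun i j h => hY j i h (by omega)
  have hpre : ∀ j Z, (∀ i, i < j → Orth (E i) Z) →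
      Function.Bijective (fun g : Y j ⟶ Z => f j ≫ g) := by
    intro j Z h
    apply (hf j).pre
    rintro _ ⟨i, hi, rfl⟩
    exact h i hi
  have hpost : ∀ i j, j ≤ i → ∀ k : ℤ,
      Function.Bijective (fun g : E i ⟶ (E j)⟦k⟧ => g ≫ (f j)⟦k⟧') := by
    intro i j h
    apply (hf j).post
    rintro _ ⟨a, ha, rfl⟩
    exact hseq a i (lt_of_lt_of_le ha h)
  have hz : ∀ (i j : Fin (m + 1)) (k : ℤ), ¬ (i = j ∧ k = 0) →
      ∀ φ : E i ⟶ (Y j)⟦k⟧, φ = 0 := by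
    intro i j k h φ
    rcases lt_or_ge i j with hij | hij
    · exact hY' i j hij k φ
    · obtain ⟨g, rfl⟩ := (hpost i j hij k).2 φ
      have : g = 0 := by
        rcases hij.lt_or_eq with h1 | h1
        · exact hseq j i h1 k g
        · subst h1
          exact (hexc j).2 k (by tauto) g
      simp [this]
  have hone : ∀ j, Module.finrank K (E j ⟶ (Y j)⟦(0 : ℤ)⟧) = 1 := by
    intro j
    rw [← (hexc j).1]
    have e1 := LinearEquiv.ofBijective (Linear.rightComp K (E j) ((f j)⟦(0 : ℤ)⟧'))
      (hpost j j le_rfl 0)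
    rw [← e1.finrank_eq]
    exact (Linear.homCongr K (Iso.refl (E j)) ((shiftFunctorZero T ℤ).app (E j))).finrank_eq
  refine ⟨Y, fun j => ⟨?_, ?_⟩, ?_, ?_, ?_, fun i j k => ⟨?_, hz i j k⟩⟩
  · rw [← hone j]
    have e1 := LinearEquiv.ofBijective (Linear.leftComp K (Y j) (f j))
      (hpre j (Y j) (fun i h => hY' i j h))
    rw [e1.finrank_eq]
    exact (Linear.homCongr K (Iso.refl (E j))
      ((shiftFunctorZero T ℤ).app (Y j)).symm).finrank_eq
  · intro k hk φ
    apply (hpre j ((Y j)⟦k⟧) (fun i h => (hY' i j h).shift_right k)).1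
    dsimp only
    rw [comp_zero]
    exact hz j j k (by tauto) _
  · intro i j hij k φ
    apply (hpre i ((Y j)⟦k⟧) (fun a h => (hY' a j (h.trans hij)).shift_right k)).1
    dsimp only
    rw [comp_zero]
    exact hz i j k (fun h => hij.ne h.1) _
  · have key : ∀ j, GenSub (Set.range Y) (E j) := by
      intro j
      induction j using WellFoundedLT.induction with
      | _ j ih =>
        refine ((hf j).gen _ ?_).2 (.of _ ⟨j, rfl⟩)
        rintro _ ⟨i, hi, rfl⟩
        exact ih i hi
    intro X
    refine (hfull X).trans ?_
    rintro _ ⟨j, rfl⟩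
    exact key j
  · have h0 : ∀ Z, Function.Bijective (fun g : Y 0 ⟶ Z => f 0 ≫ g) := fun Z =>
      hpre 0 Z (fun i h => absurd h (Fin.not_lt_zero i))
    obtain ⟨g, hg⟩ := (h0 (E 0)).2 (𝟙 _)
    dsimp only at hg
    refine ⟨⟨g, f 0, ?_, hg⟩⟩
    apply (h0 (Y 0)).1
    dsimp only
    rw [reassoc_of% hg, Category.comp_id]
  · rintro ⟨rfl, rfl⟩
    exact hone i
end

section
/- Let K be a field and T a K-linear triangulated category, and let E be an exceptional object of T. Suppose given a morphism u : A → B and two distinguished triangles A --u--> B --e--> E --η--> A[1] and A --u--> B --e'--> E --η'--> A[1] with the same first morphism u and the same third object E. Then there exists a nonzero scalar λ ∈ K such that e' = λ·e and η' = λ^{-1}·η. -/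
open CategoryTheory CategoryTheory.Limits CategoryTheory.Pretriangulated

/-- If `E` is exceptional and `A ⟶u B ⟶e E ⟶η A⟦1⟧`, `A ⟶u B ⟶e' E ⟶η' A⟦1⟧` are two
distinguished triangles with the same first morphism `u` and third object `E`, then
`(e', η') = (λ • e, λ⁻¹ • η)` for some nonzero scalar `λ ∈ K`. -/
theorem exists_scalar_of_two_triangles_on_exceptional
    {K : Type*} [Field K] {T : Type*} [Category T] [Preadditive T] [Linear K T]
    [HasZeroObject T] [HasShift T ℤ] [∀ n : ℤ, (shiftFunctor T n).Additive]
    [∀ n : ℤ, (shiftFunctor T n).Linear K] [Pretriangulated T]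
    {E A B : T} (hE : IsExceptional K E)
    {u : A ⟶ B} {e e' : B ⟶ E} {η η' : E ⟶ A⟦(1 : ℤ)⟧}
    (hT : Triangle.mk u e η ∈ distTriang T)
    (hT' : Triangle.mk u e' η' ∈ distTriang T) :
    ∃ lam : K, lam ≠ 0 ∧ e' = lam • e ∧ η' = lam⁻¹ • η := by
  have hid : (𝟙 E : E ⟶ E) ≠ 0 := by
    intro h
    have : Subsingleton (E ⟶ E) := ⟨fun f g => by
      rw [← Category.comp_id f, ← Category.comp_id g, h, comp_zero, comp_zero]⟩
    have h1 := hE.1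
    rw [Module.finrank_zero_of_subsingleton] at h1
    exact zero_ne_one h1
  obtain ⟨c, hc₁, hc₂⟩ := complete_distinguished_triangle_morphism _ _ hT hT' (𝟙 A) (𝟙 B)
    ((Category.comp_id u).trans (Category.id_comp u).symm)
  let φ : Triangle.mk u e η ⟶ Triangle.mk u e' η' :=
    { hom₁ := 𝟙 A, hom₂ := 𝟙 B, hom₃ := c, comm₁ := (Category.comp_id u).trans (Category.id_comp u).symm, comm₂ := hc₁, comm₃ := hc₂ }
  have hiso : IsIso c := isIso₃_of_isIso₁₂ φ hT hT'
    (inferInstanceAs (IsIso (𝟙 A))) (inferInstanceAs (IsIso (𝟙 B)))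
  change E ⟶ E at c
  change @IsIso T _ E E c at hiso
  change e ≫ c = 𝟙 B ≫ e' at hc₁
  change η ≫ (𝟙 A)⟦(1 : ℤ)⟧' = c ≫ η' at hc₂
  obtain ⟨lam, hlam⟩ := (finrank_eq_one_iff_of_nonzero' (𝟙 E) hid).1 hE.1 c
  have h0 : lam ≠ 0 := by
    rintro rfl
    rw [zero_smul] at hlam
    obtain ⟨d, h2, -⟩ := hiso.out
    apply hid
    rw [← h2, ← hlam, zero_comp]
  subst hlam
  rw [Linear.comp_smul, Category.comp_id, Category.id_comp] at hc₁
  rw [CategoryTheory.Functor.map_id, Category.comp_id, Linear.smul_comp, Category.id_comp] at hc₂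
  exact ⟨lam, h0, hc₁.symm, by rw [hc₂, smul_smul, inv_mul_cancel₀ h0, one_smul]⟩
end

section
/- Let K be a field and T a K-linear triangulated category such that for all objects A, B of T the K-vector space ⊕_{k∈ℤ} Hom_T(A, B[k]) is finite-dimensional. Let E be an exceptional object of T and let F be an object of ⟨{E}⟩ (the smallest strictly full triangulated subcategory of T containing E) such that Hom_T(E, F) is 1-dimensional over K and Hom_T(E, F[k]) = 0 for all k ≠ 0. Then F ≅ E. -/
open CategoryTheory CategoryTheory.Limits CategoryTheory.Pretriangulated

section

variable {T : Type*} [Category T] [Preadditive T] [HasZeroObject T] [HasShift T ℤ]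
  [∀ n : ℤ, (shiftFunctor T n).Additive] [Pretriangulated T]

theorem aux_shift {X Y : T} {k m n : ℤ} (hn : k + m = n) (h : ∀ g : X ⟶ Y⟦k⟧, g = 0)
    (g : X⟦m⟧ ⟶ Y⟦n⟧) : g = 0 := by
  obtain ⟨u, hu⟩ := (shiftFunctor T m).map_surjective
    (g ≫ (shiftFunctorAdd' T k m n hn).hom.app Y)
  rw [h u, Functor.map_zero] at hu
  rw [← cancel_mono ((shiftFunctorAdd' T k m n hn).hom.app Y), ← hu, zero_comp]

theorem aux_shift_zero_s8 {X Y : T} {k m : ℤ} (hn : k + m = 0) (h : ∀ g : X ⟶ Y⟦k⟧, g = 0)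
    (g : X⟦m⟧ ⟶ Y) : g = 0 := by
  have := aux_shift hn h (g ≫ (shiftFunctorZero T ℤ).inv.app Y)
  rw [← cancel_mono ((shiftFunctorZero T ℤ).inv.app Y), this, zero_comp]

theorem aux_unshift {X Y : T} (h : ∀ (m : ℤ) (g : X⟦m⟧ ⟶ Y), g = 0) (k : ℤ)
    (g : X ⟶ Y⟦k⟧) : g = 0 := by
  apply (shiftFunctor T (-k)).map_injective
  rw [Functor.map_zero,
    ← cancel_mono ((shiftFunctorCompIsoId T k (-k) (by lia)).hom.app Y), zero_comp]
  exact h _ _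

theorem aux_gen {E C X : T} (hX : GenSub {E} X) (h : ∀ (k : ℤ) (g : E ⟶ C⟦k⟧), g = 0) :
    ∀ (k : ℤ) (g : X ⟶ C⟦k⟧), g = 0 := by
  induction hX with
  | of X hX => rw [Set.mem_singleton_iff] at hX; subst hX; exact h
  | zero X hX => intro k g; exact hX.eq_of_src _ _
  | isoClosed e _ ih =>
    intro k g
    rw [← cancel_epi e.hom, ih k (e.hom ≫ g), comp_zero]
  | shift X n _ ih =>
    intro k g
    exact aux_shift (k := k - n) (by lia) (ih _) g
  | ext Tr hTr _ _ ih₁ ih₂ =>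
    intro k g
    obtain ⟨u, hu⟩ := Triangle.yoneda_exact₃ Tr hTr g (ih₂ _ _)
    rw [hu, aux_shift (k := k - 1) (by lia) (ih₁ _) u, comp_zero]

end

/-- If `E` is an exceptional object and `F ∈ ⟨E⟩` satisfies `Hom(E, F) ≅ K` and
`Hom(E, F⟦k⟧) = 0` for `k ≠ 0`, then `F ≅ E`. -/
theorem iso_exceptional_of_hom_conditions
    {K : Type*} [Field K] {T : Type*} [Category T] [Preadditive T] [Linear K T]
    [HasZeroObject T] [HasShift T ℤ] [∀ n : ℤ, (shiftFunctor T n).Additive]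
    [∀ n : ℤ, (shiftFunctor T n).Linear K] [Pretriangulated T]
    (hfin : ∀ A B : T, FiniteDimensional K (DirectSum ℤ (fun k : ℤ => A ⟶ B⟦k⟧)))
    (E F : T) (hE : IsExceptional K E) (hF : GenSub {E} F)
    (h₀ : Module.finrank K (E ⟶ F) = 1)
    (hk : ∀ k : ℤ, k ≠ 0 → ∀ φ : E ⟶ F⟦k⟧, φ = 0) :
    Nonempty (F ≅ E) := by
  obtain ⟨hE1, hE0⟩ := hE
  have hf : ∃ f : E ⟶ F, f ≠ 0 := by
    by_contra! hcon
    have : Subsingleton (E ⟶ F) := ⟨fun a b => by rw [hcon a, hcon b]⟩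
    rw [Module.finrank_zero_of_subsingleton] at h₀
    exact zero_ne_one h₀
  obtain ⟨f, hf⟩ := hf
  have hid : 𝟙 E ≠ 0 := fun hid => hf (by rw [← Category.id_comp f, hid, zero_comp])
  have hspan := (finrank_eq_one_iff_of_nonzero' f hf).1 h₀
  have hspanE := (finrank_eq_one_iff_of_nonzero' (𝟙 E) hid).1 hE1
  obtain ⟨C, p, d, hT⟩ := distinguished_cocone_triangle f
  have hfp : f ≫ p = 0 := comp_distTriang_mor_zero₁₂ _ hT
  have hdf : d ≫ f⟦(1 : ℤ)⟧' = 0 := comp_distTriang_mor_zero₃₁ _ hT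
  have hC : ∀ (m : ℤ) (g : E⟦m⟧ ⟶ C), g = 0 := by
    intro m g
    have hgd : g ≫ d = 0 := by
      by_cases hm : m = 1
      · subst hm
        obtain ⟨u, hu⟩ := (shiftFunctor T (1 : ℤ)).map_surjective (g ≫ d)
        obtain ⟨c, rfl⟩ := hspanE u
        have h1 : (shiftFunctor T (1 : ℤ)).map ((c • 𝟙 E) ≫ f) = 0 := by
          rw [Functor.map_comp, hu, Category.assoc, hdf, comp_zero]
        have h2 : (c • 𝟙 E) ≫ f = 0 :=
          (shiftFunctor T (1 : ℤ)).map_injective (by rw [h1, Functor.map_zero])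
        rw [Linear.smul_comp, Category.id_comp] at h2
        have hc : c = 0 := (smul_eq_zero.1 h2).resolve_right hf
        rw [← hu, hc, zero_smul, Functor.map_zero]
      · exact aux_shift (k := 1 - m) (by lia) (hE0 _ (by lia)) _
    obtain ⟨h, rfl⟩ : ∃ h : E⟦m⟧ ⟶ F, g = h ≫ p := Triangle.coyoneda_exact₃ _ hT g hgd
    by_cases hm : m = 0
    · subst hm
      obtain ⟨c, hc⟩ := hspan ((shiftFunctorZero T ℤ).inv.app E ≫ h)
      rw [← cancel_epi ((shiftFunctorZero T ℤ).inv.app E), comp_zero, ← Category.assoc, ← hc,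
        Linear.smul_comp, hfp, smul_zero]
    · rw [aux_shift_zero_s8 (k := -m) (by lia) (hk _ (by lia)) h, zero_comp]
  have hCgen : GenSub {E} C := GenSub.ext _ hT (GenSub.of E rfl) hF
  have hCz : IsZero C := by
    have := aux_gen hCgen (aux_unshift hC) 0 ((shiftFunctorZero T ℤ).inv.app C)
    rw [IsZero.iff_id_eq_zero]
    have h3 := (shiftFunctorZero T ℤ).inv_hom_id_app C
    rw [this, zero_comp] at h3
    exact h3.symm
  have : IsIso f := (Triangle.isZero₃_iff_isIso₁ _ hT).1 hCz
  exact ⟨(asIso f).symm⟩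
end

section
/- Let K be a field and T a K-linear triangulated category such that for all objects A, B of T the K-vector space ⊕_{k∈ℤ} Hom_T(A, B[k]) is finite-dimensional. Let (E_0, …, E_m) be a full exceptional sequence in T and fix 0 ≤ n < m. Then for every object X of T there exists a distinguished triangle X_1 --u--> X --v--> X_0 --w--> X_1[1] with X_1 an object of ⟨{E_{n+1}, …, E_m}⟩ and X_0 an object of ⟨{E_0, …, E_n}⟩, and this triangle is unique up to isomorphism: for any other such distinguished triangle X_1' --u'--> X --v'--> X_0' --w'--> X_1'[1] with X_1' in ⟨{E_{n+1}, …, E_m}⟩ and X_0' in ⟨{E_0, …, E_n}⟩, there exist isomorphisms a : X_1 → X_1' and a' : X_0 → X_0' with u' ∘ a = u, a' ∘ v = v', and a[1] ∘ w = w' ∘ a'. -/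
open CategoryTheory CategoryTheory.Limits CategoryTheory.Pretriangulated

open ZeroObject

section Helpers

variable {T : Type*} [Category T] [Preadditive T] [HasZeroObject T] [HasShift T ℤ]
  [∀ n : ℤ, (shiftFunctor T n).Additive] [Pretriangulated T]

def genP (S : Set T) : ObjectProperty T := GenSub S

instance genP_iso (S : Set T) : (genP S).IsClosedUnderIsomorphisms where
  of_iso e h := GenSub.isoClosed e h

instance genP_shift (S : Set T) : (genP S).IsStableUnderShift ℤ where
  isStableUnderShiftBy a := ⟨fun X h => GenSub.shift X a h⟩

instance genP_closed₃ (S : Set T) : (genP S).IsTriangulatedClosed₃ :=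
  .mk' (fun Tr hTr h₁ h₂ => GenSub.ext Tr hTr h₁ h₂)

instance genP_closed₂ (S : Set T) : (genP S).IsTriangulatedClosed₂ :=
  .of_isTriangulatedClosed₃

instance genP_zero (S : Set T) : (genP S).ContainsZero where
  exists_zero := ⟨0, isZero_zero T, GenSub.zero _ (isZero_zero T)⟩

instance genP_triang (S : Set T) : (genP S).IsTriangulated where

lemma genP_le {S : Set T} {P : ObjectProperty T} [P.IsTriangulated]
    [P.IsClosedUnderIsomorphisms] (h : ∀ Y ∈ S, P Y) {Y : T} (hY : GenSub S Y) : P Y := by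
  induction hY with
  | of X hX => exact h X hX
  | zero X hX => exact P.prop_of_isZero hX
  | isoClosed e _ ih => exact P.prop_of_iso e ih
  | shift X n _ ih => exact P.le_shift n X ih
  | ext Tr hTr _ _ h₁ h₂ => exact P.ext_of_isTriangulatedClosed₃ Tr hTr h₁ h₂

/-- No maps from `Y` to any shift of `W`. -/
def OR (Y W : T) : Prop := ∀ (k : ℤ) (f : Y ⟶ W⟦k⟧), f = 0

def shP (W : T) : ObjectProperty T := fun Z => ∃ k : ℤ, Nonempty (Z ≅ W⟦k⟧)

instance shP_shift (W : T) : (shP W).IsStableUnderShift ℤ where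
  isStableUnderShiftBy a := ⟨by
    rintro X ⟨k, ⟨e⟩⟩
    exact ⟨k + a, ⟨(shiftFunctor T a).mapIso e ≪≫ ((shiftFunctorAdd T k a).app W).symm⟩⟩⟩

lemma OR_iff (Y W : T) : OR Y W ↔ (shP W).leftOrthogonal Y := by
  constructor
  · rintro h Z f ⟨k, ⟨e⟩⟩
    have := h k (f ≫ e.hom)
    simpa using this
  · intro h k f
    exact h f ⟨k, ⟨Iso.refl _⟩⟩

lemma OR_gen {S : Set T} {W : T} (h : ∀ Y ∈ S, OR Y W) {Y : T} (hY : GenSub S Y) : OR Y W := by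
  rw [OR_iff]
  exact genP_le (P := (shP W).leftOrthogonal) (fun Z hZ => (OR_iff _ _).1 (h Z hZ)) hY

lemma OR.zero {Y W : T} (h : OR Y W) (f : Y ⟶ W) : f = 0 := by
  rw [OR_iff] at h
  exact h f ⟨0, ⟨((shiftFunctorZero T ℤ).app W).symm⟩⟩

/-- isomorphism on Hom from the subcategory generated by `S`. -/
def Good_s9 (S : Set T) {X₁ X : T} (u : X₁ ⟶ X) : Prop :=
  ∀ A : T, GenSub S A → Function.Bijective (fun f : A ⟶ X₁ => f ≫ u)

lemma Good_s9.inj {S : Set T} {X₁ X : T} {u : X₁ ⟶ X} (h : Good_s9 S u) {A : T} (hA : GenSub S A)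
    (f : A ⟶ X₁) (hf : f ≫ u = 0) : f = 0 :=
  (h A hA).1 (by simpa using hf)

lemma Good_s9.surj {S : Set T} {X₁ X : T} {u : X₁ ⟶ X} (h : Good_s9 S u) {A : T} (hA : GenSub S A)
    (f : A ⟶ X) : ∃ g : A ⟶ X₁, g ≫ u = f := (h A hA).2 f

lemma Good_s9.mk' {S : Set T} {X₁ X : T} {u : X₁ ⟶ X}
    (h₁ : ∀ A : T, GenSub S A → ∀ f : A ⟶ X₁, f ≫ u = 0 → f = 0)
    (h₂ : ∀ A : T, GenSub S A → ∀ f : A ⟶ X, ∃ g : A ⟶ X₁, g ≫ u = f) : Good_s9 S u := by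
  intro A hA
  refine ⟨fun f g hfg => ?_, h₂ A hA⟩
  rw [← sub_eq_zero]
  apply h₁ A hA
  simpa [sub_eq_zero] using hfg

lemma exists_shift_rep (A X : T) (n : ℤ) (f : A ⟶ X⟦n⟧) :
    ∃ g : A⟦-n⟧ ⟶ X, f = (shiftFunctorCompIsoId T (-n) n (by simp)).inv.app A ≫ g⟦n⟧' := by
  obtain ⟨g, hg⟩ := (shiftFunctor T n).map_surjective
    ((shiftFunctorCompIsoId T (-n) n (by simp)).hom.app A ≫ f)
  refine ⟨g, ?_⟩
  rw [hg]
  simp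

lemma Good_s9.shift {S : Set T} {X₁ X : T} {u : X₁ ⟶ X} (h : Good_s9 S u) (n : ℤ) :
    Good_s9 S (u⟦n⟧') := by
  apply Good_s9.mk'
  · intro A hA f hf
    obtain ⟨g, rfl⟩ := exists_shift_rep A X₁ n f
    have : g = 0 := by
      apply h.inj (GenSub.shift A (-n) hA)
      apply (shiftFunctor T n).map_injective
      rw [Category.assoc, ← Functor.map_comp] at hf
      simpa using hf
    simp [this]
  · intro A hA f
    obtain ⟨g, rfl⟩ := exists_shift_rep A X n f
    obtain ⟨g', rfl⟩ := h.surj (GenSub.shift A (-n) hA) g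
    exact ⟨_, by rw [Functor.map_comp, ← Category.assoc]⟩

lemma Good_s9.comp_iso {S : Set T} {X₁ X Y : T} {u : X₁ ⟶ X} (h : Good_s9 S u) (e : X ≅ Y) :
    Good_s9 S (u ≫ e.hom) := by
  apply Good_s9.mk'
  · intro A hA f hf
    exact h.inj hA f (by simpa [← Category.assoc] using hf)
  · intro A hA f
    obtain ⟨g, hg⟩ := h.surj hA (f ≫ e.inv)
    exact ⟨g, by rw [← Category.assoc, hg]; simp⟩

/-- Five lemma. -/
lemma Good_s9.five {S : Set T} {X Y Z X₁ Y₁ Z₁ : T} {f : X ⟶ Y} {g : Y ⟶ Z} {d : Z ⟶ X⟦(1 : ℤ)⟧}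
    (hT : Triangle.mk f g d ∈ distTriang T)
    {f₁ : X₁ ⟶ Y₁} {g₁ : Y₁ ⟶ Z₁} {d₁ : Z₁ ⟶ X₁⟦(1 : ℤ)⟧}
    (hT₁ : Triangle.mk f₁ g₁ d₁ ∈ distTriang T)
    {a : X₁ ⟶ X} {b : Y₁ ⟶ Y} {c : Z₁ ⟶ Z} (h₁ : f₁ ≫ b = a ≫ f) (h₂ : g₁ ≫ c = b ≫ g)
    (h₃ : d₁ ≫ a⟦(1 : ℤ)⟧' = c ≫ d) (ha : Good_s9 S a) (hb : Good_s9 S b) : Good_s9 S c := by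
  have hd : d ≫ f⟦(1 : ℤ)⟧' = 0 := comp_distTriang_mor_zero₃₁ _ hT
  have hfg₁ : f₁ ≫ g₁ = 0 := comp_distTriang_mor_zero₁₂ _ hT₁
  have ha1 := ha.shift 1
  have hb1 := hb.shift 1
  apply Good_s9.mk'
  · intro A hA z hz
    have e1 : z ≫ d₁ = 0 := by
      apply ha1.inj hA
      rw [Category.assoc, h₃, ← Category.assoc, hz, zero_comp]
    obtain ⟨y, hy⟩ : ∃ y : A ⟶ Y₁, z = y ≫ g₁ := Triangle.coyoneda_exact₃ _ hT₁ z e1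
    obtain ⟨x, hx⟩ : ∃ x : A ⟶ X, y ≫ b = x ≫ f := Triangle.coyoneda_exact₂ _ hT (y ≫ b) (by
      change (y ≫ b) ≫ g = 0
      rw [Category.assoc, ← h₂, ← Category.assoc, ← hy, hz])
    obtain ⟨x', rfl⟩ := ha.surj hA x
    have e2 : y - x' ≫ f₁ = 0 := by
      apply hb.inj hA
      rw [Preadditive.sub_comp, hx, Category.assoc, Category.assoc, h₁, sub_self]
    rw [sub_eq_zero] at e2
    rw [hy, e2, Category.assoc, hfg₁, comp_zero]
  · intro A hA z
    obtain ⟨x, hx⟩ := ha1.surj hA (z ≫ d)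
    have e1 : x ≫ f₁⟦(1 : ℤ)⟧' = 0 := by
      apply hb1.inj hA
      rw [Category.assoc, ← Functor.map_comp, h₁, Functor.map_comp, ← Category.assoc, hx,
        Category.assoc, hd, comp_zero]
    obtain ⟨z', hz'⟩ : ∃ z' : A ⟶ Z₁, x = z' ≫ d₁ := Triangle.coyoneda_exact₁ _ hT₁ x e1
    obtain ⟨y, hy⟩ : ∃ y : A ⟶ Y, z - z' ≫ c = y ≫ g :=
      Triangle.coyoneda_exact₃ _ hT (z - z' ≫ c) (by
        change (z - z' ≫ c) ≫ d = 0
        rw [Preadditive.sub_comp, ← hx, hz', Category.assoc, Category.assoc, h₃, sub_self])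
    obtain ⟨y', rfl⟩ := hb.surj hA y
    refine ⟨z' + y' ≫ g₁, ?_⟩
    rw [Preadditive.add_comp, Category.assoc, h₂, ← Category.assoc, ← hy]
    abel

lemma exists_good {S S' : Set T} (hS : ∀ Y ∈ S', Y ∈ S ∨ ∀ A ∈ S, OR A Y) {X : T}
    (hX : GenSub S' X) : ∃ (X₁ : T) (u : X₁ ⟶ X), GenSub S X₁ ∧ Good_s9 S u := by
  induction hX with
  | of X hX =>
    rcases hS X hX with h | h
    · exact ⟨X, 𝟙 X, .of X h, .mk' (fun A _ f hf => by simpa using hf)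
        (fun A _ f => ⟨f, by simp⟩)⟩
    · exact ⟨0, 0, .zero _ (isZero_zero T), .mk' (fun A _ f _ => (isZero_zero T).eq_of_tgt _ _)
        (fun A hA f => ⟨0, by rw [(OR_gen h hA).zero f]; simp⟩)⟩
  | zero X hX =>
    exact ⟨X, 𝟙 X, .zero X hX, .mk' (fun A _ f hf => by simpa using hf)
        (fun A _ f => ⟨f, by simp⟩)⟩
  | isoClosed e _ ih =>
    obtain ⟨X₁, u, h₁, h₂⟩ := ih
    exact ⟨X₁, _, h₁, h₂.comp_iso e⟩
  | shift X n _ ih =>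
    obtain ⟨X₁, u, h₁, h₂⟩ := ih
    exact ⟨_, _, h₁.shift _ n, h₂.shift n⟩
  | ext Tr hTr _ _ ih₁ ih₂ =>
    obtain ⟨X₁, a, hX₁, ha⟩ := ih₁
    obtain ⟨Y₁, b, hY₁, hb⟩ := ih₂
    obtain ⟨f₁, hf₁⟩ := hb.surj hX₁ (a ≫ Tr.mor₁)
    obtain ⟨Z₁, g₁, d₁, hT₁⟩ := distinguished_cocone_triangle f₁
    obtain ⟨c, hc₁, hc₂⟩ := complete_distinguished_triangle_morphism _ _ hT₁ hTr a b hf₁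
    exact ⟨Z₁, c, GenSub.ext _ hT₁ hX₁ hY₁, Good_s9.five hTr hT₁ hf₁ hc₁ hc₂ ha hb⟩

lemma Good_s9.orth {S : Set T} {X₁ X W : T} {u : X₁ ⟶ X} {v : X ⟶ W} {w : W ⟶ X₁⟦(1 : ℤ)⟧}
    (hT : Triangle.mk u v w ∈ distTriang T) (h : Good_s9 S u) {A : T} (hA : GenSub S A)
    (f : A ⟶ W) : f = 0 := by
  have huv : u ≫ v = 0 := comp_distTriang_mor_zero₁₂ _ hT
  have hwu : w ≫ u⟦(1 : ℤ)⟧' = 0 := comp_distTriang_mor_zero₃₁ _ hT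
  have e : f ≫ w = 0 := (h.shift 1).inj hA _ (by rw [Category.assoc, hwu, comp_zero])
  obtain ⟨g, hg⟩ : ∃ g : A ⟶ X, f = g ≫ v := Triangle.coyoneda_exact₃ _ hT f e
  obtain ⟨g', rfl⟩ := h.surj hA g
  rw [hg, Category.assoc, huv, comp_zero]

lemma orth_OR {S : Set T} {W : T} (h : ∀ A, GenSub S A → ∀ f : A ⟶ W, f = 0) {A : T}
    (hA : GenSub S A) : OR A W := by
  intro k f
  obtain ⟨g, rfl⟩ := exists_shift_rep A W k f
  simp [h _ (hA.shift _ (-k)) g]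

/-- exactness for shifted triangle -/
lemma exact_shift₃ {A X Y Z : T} {f : X ⟶ Y} {g : Y ⟶ Z} {d : Z ⟶ X⟦(1 : ℤ)⟧}
    (hT : Triangle.mk f g d ∈ distTriang T) (k : ℤ) (z : A ⟶ Z⟦k⟧) (hz : z ≫ d⟦k⟧' = 0) :
    ∃ y : A ⟶ Y⟦k⟧, y ≫ g⟦k⟧' = z := by
  obtain ⟨z', rfl⟩ := exists_shift_rep A Z k z
  have e : z' ≫ d = 0 := by
    apply (shiftFunctor T k).map_injective
    rw [Category.assoc, ← Functor.map_comp] at hz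
    simpa using hz
  obtain ⟨y, hy⟩ : ∃ y : A⟦-k⟧ ⟶ Y, z' = y ≫ g := Triangle.coyoneda_exact₃ _ hT z' e
  exact ⟨_, by rw [hy, Functor.map_comp, ← Category.assoc]⟩

/-- uniqueness -/
lemma tri_unique {P Q : ObjectProperty T} [Q.IsStableUnderShift ℤ]
    (hPQ : ∀ A B, P A → Q B → ∀ f : A ⟶ B, f = 0)
    {X X₁ X₀ X₁' X₀' : T} {u : X₁ ⟶ X} {v : X ⟶ X₀} {w : X₀ ⟶ X₁⟦(1 : ℤ)⟧}
    {u' : X₁' ⟶ X} {v' : X ⟶ X₀'} {w' : X₀' ⟶ X₁'⟦(1 : ℤ)⟧}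
    (hT : Triangle.mk u v w ∈ distTriang T) (hT' : Triangle.mk u' v' w' ∈ distTriang T)
    (h₁ : P X₁) (h₀ : Q X₀) (h₁' : P X₁') (h₀' : Q X₀') :
    ∃ (a : X₁ ≅ X₁') (a' : X₀ ≅ X₀'),
          a.hom ≫ u' = u ∧ v ≫ a'.hom = v' ∧
          w ≫ (shiftFunctor T (1 : ℤ)).map a.hom = a'.hom ≫ w' := by
  have key : ∀ {X₁ X₀ : T} {u : X₁ ⟶ X} {v : X ⟶ X₀} {w : X₀ ⟶ X₁⟦(1 : ℤ)⟧},
      Triangle.mk u v w ∈ distTriang T → Q X₀ → P X₁ →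
      ∀ f : X₁ ⟶ X₁, f ≫ u = u → f = 𝟙 _ := by
    intro X₁ X₀ u v w hT h₀ h₁ f hf
    rw [← sub_eq_zero]
    obtain ⟨g, hg⟩ := Triangle.coyoneda_exact₂ _ (inv_rot_of_distTriang _ hT) (f - 𝟙 X₁) (by
      change (f - 𝟙 X₁) ≫ u = 0
      rw [Preadditive.sub_comp, hf, Category.id_comp, sub_self])
    rw [hg, hPQ _ _ h₁ (Q.le_shift (-1) _ h₀) g]
    exact zero_comp
  obtain ⟨a, ha⟩ : ∃ a : X₁ ⟶ X₁', u = a ≫ u' :=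
    Triangle.coyoneda_exact₂ _ hT' u (hPQ _ _ h₁ h₀' _)
  obtain ⟨b, hb⟩ : ∃ b : X₁' ⟶ X₁, u' = b ≫ u :=
    Triangle.coyoneda_exact₂ _ hT u' (hPQ _ _ h₁' h₀ _)
  have hab : a ≫ b = 𝟙 _ := key hT h₀ h₁ _ (by rw [Category.assoc, ← hb, ← ha])
  have hba : b ≫ a = 𝟙 _ := key hT' h₀' h₁' _ (by rw [Category.assoc, ← ha, ← hb])
  let φ : X₁ ≅ X₁' := ⟨a, b, hab, hba⟩
  have hcomm : u ≫ 𝟙 X = a ≫ u' := (Category.comp_id u).trans ha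
  obtain ⟨c, hc₁, hc₂⟩ : ∃ c : X₀ ⟶ X₀', v ≫ c = 𝟙 X ≫ v' ∧ w ≫ a⟦(1 : ℤ)⟧' = c ≫ w' :=
    complete_distinguished_triangle_morphism _ _ hT hT' a (𝟙 X) hcomm
  have i1 : IsIso a := ⟨b, hab, hba⟩
  have i2 : IsIso (𝟙 X) := inferInstance
  have : IsIso c := isIso₃_of_isIso₁₂ (T := Triangle.mk u v w) (T' := Triangle.mk u' v' w')
    (Triangle.homMk _ _ a (𝟙 X) c hcomm hc₁ hc₂) hT hT' i1 i2
  exact ⟨φ, asIso c, ha.symm, by simpa using hc₁, hc₂⟩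

end Helpers

section Lin

variable {K : Type*} [Field K] {T : Type*} [Category T] [Preadditive T] [Linear K T]
    [HasZeroObject T] [HasShift T ℤ] [∀ n : ℤ, (shiftFunctor T n).Additive]
    [∀ n : ℤ, (shiftFunctor T n).Linear K] [Pretriangulated T]

def isoShift (E : T) (a b c d : ℤ) (h : a + b + c = d) : ((E⟦a⟧)⟦b⟧)⟦c⟧ ≅ E⟦d⟧ :=
  (shiftFunctor T c).mapIso ((shiftFunctorAdd' T a b (a + b) rfl).symm.app E) ≪≫
    (shiftFunctorAdd' T (a + b) c d h).symm.app E

lemma exc_surj {E W V : T} (hE : IsExceptional K E) (k : ℤ) (f : E⟦k⟧ ⟶ W) (hf : f ≠ 0)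
    {g : W ⟶ V} {d : V ⟶ E⟦k⟧⟦(1 : ℤ)⟧} (hT : Triangle.mk f g d ∈ distTriang T) (j : ℤ)
    (z : E ⟶ V⟦j⟧) : ∃ y : E ⟶ W⟦j⟧, y ≫ g⟦j⟧' = z := by
  apply exact_shift₃ hT
  have hdf : d ≫ f⟦(1 : ℤ)⟧' = 0 := comp_distTriang_mor_zero₃₁ _ hT
  have h0 : (z ≫ d⟦j⟧') ≫ (f⟦(1 : ℤ)⟧')⟦j⟧' = 0 := by
    rw [Category.assoc, ← Functor.map_comp, hdf, Functor.map_zero, comp_zero]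
  generalize z ≫ d⟦j⟧' = ψ at h0
  by_cases hj : k + 1 + j = 0
  · let e : ((E⟦k⟧)⟦(1 : ℤ)⟧)⟦j⟧ ≅ E := isoShift E k 1 j 0 hj ≪≫ (shiftFunctorZero T ℤ).app E
    have hid : 𝟙 E ≠ 0 := by
      intro h
      have : Subsingleton (E ⟶ E) := ⟨fun a b => by
        rw [← Category.comp_id a, ← Category.comp_id b, h, comp_zero, comp_zero]⟩
      have := hE.1
      rw [Module.finrank_zero_of_subsingleton] at this
      exact zero_ne_one this
    obtain ⟨c, hc⟩ := (finrank_eq_one_iff_of_nonzero' (𝟙 E) hid).1 hE.1 (ψ ≫ e.hom)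
    have hψ : ψ = c • e.inv := by
      rw [← cancel_mono e.hom, ← hc]
      simp
    rw [hψ, Linear.smul_comp, smul_eq_zero] at h0
    rcases h0 with h0 | h0
    · rw [hψ, h0, zero_smul]
    · exfalso
      apply hf
      apply (shiftFunctor T (1 : ℤ)).map_injective
      apply (shiftFunctor T j).map_injective
      rw [← cancel_epi e.inv, h0]
      simp
  · have := hE.2 _ hj (ψ ≫ (isoShift E k 1 j _ rfl).hom)
    simpa using this

lemma peel (hfin : ∀ A B : T, FiniteDimensional K (DirectSum ℤ (fun k : ℤ => A ⟶ B⟦k⟧)))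
    {E : T} (hE : IsExceptional K E) {S R : Set T} (hES : E ∈ S)
    (hR : ∀ A ∈ R, OR A E)
    (hbase : ∀ W : T, (∀ A ∈ R, OR A W) → OR E W → GenSub S W)
    (N : ℕ) : ∀ W : T, (∀ A ∈ R, OR A W) →
      Module.finrank K (DirectSum ℤ (fun k : ℤ => E ⟶ W⟦k⟧)) ≤ N → GenSub S W := by
  induction N with
  | zero =>
    intro W hW hN
    apply hbase W hW
    intro k f
    have := hfin E W
    have hs := Module.finrank_zero_iff.1 (Nat.le_zero.1 hN)
    apply DirectSum.of_injective (β := fun k : ℤ => E ⟶ W⟦k⟧) k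
    exact Subsingleton.elim _ _
  | succ N ih =>
    intro W hW hN
    by_cases hEW : OR E W
    · exact hbase W hW hEW
    · simp only [OR, not_forall] at hEW
      obtain ⟨k, f, hf⟩ := hEW
      obtain ⟨f', rfl⟩ := exists_shift_rep E W k f
      have hf' : f' ≠ 0 := by
        rintro rfl
        exact hf (by simp)
      obtain ⟨V, g, d, hT⟩ := distinguished_cocone_triangle f'
      have hfg : f' ≫ g = 0 := comp_distTriang_mor_zero₁₂ _ hT
      have hV : GenSub S V := by
        apply ih
        · intro A hA j z
          obtain ⟨y, rfl⟩ := exact_shift₃ hT j z (by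
            have := hR A hA _ ((z ≫ d⟦j⟧') ≫ (isoShift E (-k) 1 j _ rfl).hom)
            rwa [Preadditive.IsIso.comp_right_eq_zero] at this)
          rw [hW A hA j y, zero_comp]
        · have i1 := hfin E W
          have i2 := hfin E V
          let φ : DirectSum ℤ (fun k : ℤ => E ⟶ W⟦k⟧) →ₗ[K]
              DirectSum ℤ (fun k : ℤ => E ⟶ V⟦k⟧) :=
            DirectSum.lmap (fun j => Linear.rightComp K E (g⟦j⟧'))
          have hφ : Function.Surjective φ :=
            (DirectSum.lmap_surjective _).2 (fun j z => exc_surj hE _ f' hf' hT j z)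
          have hr := φ.finrank_range_add_finrank_ker
          rw [LinearMap.range_eq_top.2 hφ, finrank_top] at hr
          have hk : 0 < Module.finrank K (LinearMap.ker φ) := by
            rw [Module.finrank_pos_iff]
            rw [Submodule.nontrivial_iff_ne_bot, Submodule.ne_bot_iff]
            refine ⟨DirectSum.lof K ℤ (fun k : ℤ => E ⟶ W⟦k⟧) k
              ((shiftFunctorCompIsoId T (-k) k (by simp)).inv.app E ≫ f'⟦k⟧'), ?_, ?_⟩
            · rw [LinearMap.mem_ker, DirectSum.lmap_lof]
              have : Linear.rightComp K E (g⟦k⟧')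
                ((shiftFunctorCompIsoId T (-k) k (by simp)).inv.app E ≫ f'⟦k⟧') = 0 := by
                rw [Linear.rightComp_apply, Category.assoc, ← Functor.map_comp, hfg]
                simp
              rw [this, map_zero]
            · intro h
              apply hf
              apply DirectSum.of_injective (β := fun k : ℤ => E ⟶ W⟦k⟧) k
              rw [map_zero]
              exact h
          omega
      exact (genP S).ext_of_isTriangulatedClosed₂ _ hT
        (GenSub.shift E (-k) (GenSub.of E hES)) hV

lemma orth_sub (hfin : ∀ A B : T, FiniteDimensional K (DirectSum ℤ (fun k : ℤ => A ⟶ B⟦k⟧)))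
    (m : ℕ) (E : Fin (m + 1) → T)
    (hexc : ∀ i, IsExceptional K (E i))
    (hseq : ∀ i j : Fin (m + 1), i < j → ∀ (k : ℤ) (φ : E j ⟶ (E i)⟦k⟧), φ = 0)
    (hfull : ∀ X : T, GenSub (Set.range E) X) (n : ℕ) (hn : n < m) (t : ℕ) (ht : t ≤ n + 1) :
    ∀ W : T, (∀ i : Fin (m + 1), t ≤ (i : ℕ) → OR (E i) W) →
      GenSub {Y : T | ∃ i : Fin (m + 1), (i : ℕ) ≤ n ∧ Y = E i} W := by
  induction t with
  | zero =>
    intro W hW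
    apply GenSub.zero
    rw [IsZero.iff_id_eq_zero]
    apply OR.zero
    refine OR_gen ?_ (hfull W)
    rintro _ ⟨i, rfl⟩
    exact hW i (Nat.zero_le _)
  | succ t ih =>
    intro W hW
    let i : Fin (m + 1) := ⟨t, by omega⟩
    refine peel hfin (hexc i) (S := {Y : T | ∃ i : Fin (m + 1), (i : ℕ) ≤ n ∧ Y = E i})
      (R := {Y | ∃ j : Fin (m + 1), t + 1 ≤ (j : ℕ) ∧ Y = E j})
      ⟨i, by change t ≤ n; omega, rfl⟩ ?_ ?_ _ W ?_ le_rfl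
    · rintro _ ⟨j, hj, rfl⟩
      exact hseq i j (by rw [Fin.lt_def]; exact hj)
    · intro W hW hi
      refine ih (by omega) W ?_
      intro j hj
      rcases Nat.eq_or_lt_of_le hj with h | h
      · have : j = i := Fin.ext h.symm
        rw [this]
        exact hi
      · exact hW _ ⟨j, h, rfl⟩
    · rintro _ ⟨j, hj, rfl⟩
      exact hW j hj

end Lin

/-- If `(E 0, …, E m)` is a full exceptional sequence and `0 ≤ n < m`, then every object
`X` fits in a distinguished triangle `X₁ ⟶ X ⟶ X₀ ⟶ X₁⟦1⟧` with
`X₁ ∈ ⟨E (n+1), …, E m⟩` and `X₀ ∈ ⟨E 0, …, E n⟩`, and this triangle is unique up to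
isomorphism. -/
theorem exceptional_sequence_semiorthogonal_triangle
    {K : Type*} [Field K] {T : Type*} [Category T] [Preadditive T] [Linear K T]
    [HasZeroObject T] [HasShift T ℤ] [∀ n : ℤ, (shiftFunctor T n).Additive]
    [∀ n : ℤ, (shiftFunctor T n).Linear K] [Pretriangulated T]
    (hfin : ∀ A B : T, FiniteDimensional K (DirectSum ℤ (fun k : ℤ => A ⟶ B⟦k⟧)))
    (m : ℕ) (E : Fin (m + 1) → T)
    (hexc : ∀ i, IsExceptional K (E i))
    (hseq : ∀ i j : Fin (m + 1), i < j → ∀ (k : ℤ) (φ : E j ⟶ (E i)⟦k⟧), φ = 0)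
    (hfull : ∀ X : T, GenSub (Set.range E) X)
    (n : ℕ) (hn : n < m) (X : T) :
    ∃ (X₁ X₀ : T) (u : X₁ ⟶ X) (v : X ⟶ X₀) (w : X₀ ⟶ X₁⟦(1 : ℤ)⟧),
      GenSub {Y : T | ∃ i : Fin (m + 1), n < (i : ℕ) ∧ Y = E i} X₁ ∧
      GenSub {Y : T | ∃ i : Fin (m + 1), (i : ℕ) ≤ n ∧ Y = E i} X₀ ∧
      Triangle.mk u v w ∈ (distTriang T) ∧
      ∀ (X₁' X₀' : T) (u' : X₁' ⟶ X) (v' : X ⟶ X₀') (w' : X₀' ⟶ X₁'⟦(1 : ℤ)⟧),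
        GenSub {Y : T | ∃ i : Fin (m + 1), n < (i : ℕ) ∧ Y = E i} X₁' →
        GenSub {Y : T | ∃ i : Fin (m + 1), (i : ℕ) ≤ n ∧ Y = E i} X₀' →
        Triangle.mk u' v' w' ∈ (distTriang T) →
        ∃ (a : X₁ ≅ X₁') (a' : X₀ ≅ X₀'),
          a.hom ≫ u' = u ∧ v ≫ a'.hom = v' ∧
          w ≫ (shiftFunctor T (1 : ℤ)).map a.hom = a'.hom ≫ w' := by
  set S₁ : Set T := {Y : T | ∃ i : Fin (m + 1), n < (i : ℕ) ∧ Y = E i} with hS₁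
  set S₀ : Set T := {Y : T | ∃ i : Fin (m + 1), (i : ℕ) ≤ n ∧ Y = E i} with hS₀
  have h10 : ∀ A ∈ S₁, ∀ B ∈ S₀, OR A B := by
    rintro _ ⟨j, hj, rfl⟩ _ ⟨i, hi, rfl⟩
    exact hseq i j (by rw [Fin.lt_def]; omega)
  have hPQ : ∀ A B, genP S₁ A → genP S₀ B → ∀ f : A ⟶ B, f = 0 := by
    intro A B hA hB f
    have : (genP S₁).rightOrthogonal B := genP_le (P := (genP S₁).rightOrthogonal)
      (fun B hB A f hA => (OR_gen (fun A hA => h10 A hA B hB) hA).zero f) hB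
    exact this f hA
  obtain ⟨X₁, u, hX₁, hu⟩ := exists_good (S := S₁) (S' := Set.range E) (by
    rintro _ ⟨i, rfl⟩
    by_cases hi : n < (i : ℕ)
    · exact Or.inl ⟨i, hi, rfl⟩
    · exact Or.inr (fun A hA => h10 A hA _ ⟨i, by omega, rfl⟩)) (hfull X)
  obtain ⟨X₀, v, w, hT⟩ := distinguished_cocone_triangle u
  have hX₀ : GenSub S₀ X₀ := by
    refine orth_sub hfin m E hexc hseq hfull n hn (n + 1) le_rfl X₀ ?_
    intro i hi
    exact orth_OR (S := S₁) (fun A hA f => hu.orth hT hA f) (GenSub.of _ ⟨i, hi, rfl⟩)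
  exact ⟨X₁, X₀, u, v, w, hX₁, hX₀, hT, fun X₁' X₀' u' v' w' h₁' h₀' hT' =>
    tri_unique hPQ hT hT' hX₁ hX₀ h₁' h₀'⟩
end
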